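/- For every nonnegative integer n, a̅₅(5n+2) = 4·c₅(5n+1). -/

import Mathlib

open scoped BigOperators

/-- The q-Pochhammer infinite product `(a; q)_∞ = ∏_{k≥0} (1 - a q^k)`. -/
noncomputable def qpoch (a q : ℂ) : ℂ := ∏' k : ℕ, (1 - a * q ^ k)

/-- `φ(-q) = (q;q)_∞² / (q²;q²)_∞`. -/
noncomputable def phiNeg (q : ℂ) : ℂ := qpoch q q ^ 2 / qpoch (q ^ 2) (q ^ 2)

/-- `ψ(-q) = (q;q)_∞ (q⁴;q⁴)_∞ / (q²;q²)_∞`. -/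
noncomputable def psiNeg (q : ℂ) : ℂ :=
  qpoch q q * qpoch (q ^ 4) (q ^ 4) / qpoch (q ^ 2) (q ^ 2)


lemma qp_mult (a q : ℂ) (hq : ‖q‖ < 1) : Multipliable fun k : ℕ => 1 - a * q ^ k := by
  have := multipliable_one_add_of_summable (f := fun n : ℕ ↦ -(a * q ^ n)) (by
    simpa using (summable_geometric_of_lt_one (norm_nonneg _) hq).mul_left ‖a‖)
  simpa [sub_eq_add_neg] using this

lemma qp_ne (a q : ℂ) (hq : ‖q‖ < 1) (ha : ‖a‖ < 1) : qpoch a q ≠ 0 := by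
  unfold qpoch
  have := tprod_one_add_ne_zero_of_summable (f := fun n : ℕ ↦ -(a * q ^ n)) (by
    intro i h
    have h1 : a * q ^ i = 1 := by linear_combination -h
    have h2 : ‖a * q ^ i‖ < 1 := by
      rw [norm_mul, norm_pow]
      have := pow_le_one₀ (n := i) (norm_nonneg q) hq.le
      nlinarith [norm_nonneg a]
    rw [h1] at h2; simp at h2) (by
    simpa using (summable_geometric_of_lt_one (norm_nonneg _) hq).mul_left ‖a‖)
  simpa [sub_eq_add_neg] using this

lemma norm_pow_lt {q : ℂ} (hq : ‖q‖ < 1) {n : ℕ} (hn : n ≠ 0) : ‖q ^ n‖ < 1 := by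
  rw [norm_pow]; exact pow_lt_one₀ (norm_nonneg _) hq hn

lemma divMod_mult (N : ℕ) [NeZero N] (f : ℕ → ℂ) (hm : Multipliable f)
    (h1 : ∀ i : Fin N, Multipliable fun n : ℕ => f (n * N + i)) :
    ∏' n, f n = ∏ i : Fin N, ∏' n : ℕ, f (n * N + i) := by
  have e1 := ((Equiv.prodComm (Fin N) ℕ).trans (Nat.divModEquiv N).symm).tprod_eq f
  have e2 := (((Equiv.prodComm (Fin N) ℕ).trans (Nat.divModEquiv N).symm).multipliable_iff
    (f := f)).2 hm
  have e3 : (f ∘ ⇑((Equiv.prodComm (Fin N) ℕ).trans (Nat.divModEquiv N).symm))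
      = fun x : Fin N × ℕ => f (x.2 * N + x.1) := by
    funext x
    simp [Nat.divModEquiv]
  rw [e3] at e2
  rw [← e1]
  have e4 := Multipliable.tprod_prod' e2 h1
  rw [← tprod_fintype (L := SummationFilter.unconditional _)
    (fun i : Fin N => ∏' n : ℕ, f (n * N + i))]
  exact (tprod_congr (fun x => congrFun e3 x)).trans e4

lemma qp_split (N : ℕ) [NeZero N] (a q : ℂ) (hq : ‖q‖ < 1) :
    qpoch a q = ∏ i ∈ Finset.range N, qpoch (a * q ^ i) (q ^ N) := by
  have he : ∀ (i : Fin N) (n : ℕ), 1 - a * q ^ (n * N + (i : ℕ))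
      = 1 - (a * q ^ (i : ℕ)) * (q ^ N) ^ n := by
    intro i n
    rw [← pow_mul]; ring
  have h := divMod_mult N (fun k => 1 - a * q ^ k) (qp_mult a q hq) (by
    intro i
    simp only [he]
    exact qp_mult _ _ (norm_pow_lt hq (NeZero.ne N)))
  simp only [he] at h
  rw [Finset.prod_range]
  exact h

lemma qp_root (z a Q : ℂ) (hQ : ‖Q‖ < 1) (hz : IsPrimitiveRoot z 5) :
    qpoch a Q * qpoch (z * a) Q * qpoch (z ^ 2 * a) Q * qpoch (z ^ 3 * a) Q * qpoch (z ^ 4 * a) Q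
      = qpoch (a ^ 5) (Q ^ 5) := by
  unfold qpoch
  have m := fun b => qp_mult b Q hQ
  rw [← (m _).tprod_mul (m _), ← ((m _).mul (m _)).tprod_mul (m _),
    ← (((m _).mul (m _)).mul (m _)).tprod_mul (m _),
    ← ((((m _).mul (m _)).mul (m _)).mul (m _)).tprod_mul (m _)]
  congr 1; ext k
  have h5 := hz.pow_eq_one
  have hs := hz.geom_sum_eq_zero (by norm_num)
  simp only [Finset.sum_range_succ, Finset.sum_range_zero] at hs
  have key : ∀ x : ℂ, (1 - x) * (1 - z * x) * (1 - z ^ 2 * x) * (1 - z ^ 3 * x) * (1 - z ^ 4 * x)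
      = 1 - x ^ 5 := by
    intro x
    have h1 : (1 - z * x) * (1 - z ^ 4 * x) = 1 - (z + z ^ 4) * x + x ^ 2 := by
      linear_combination x ^ 2 * h5
    have h2 : (1 - z ^ 2 * x) * (1 - z ^ 3 * x) = 1 - (z ^ 2 + z ^ 3) * x + x ^ 2 := by
      linear_combination x ^ 2 * h5
    have h3 : (z + z ^ 4) * (z ^ 2 + z ^ 3) = -1 := by
      linear_combination (z + z ^ 2) * h5 + hs
    have h4 : (z + z ^ 4) + (z ^ 2 + z ^ 3) = -1 := by
      linear_combination hs
    calc _ = (1 - x) * ((1 - z * x) * (1 - z ^ 4 * x)) * ((1 - z ^ 2 * x) * (1 - z ^ 3 * x)) := by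
          ring
      _ = _ := by
          rw [h1, h2]
          linear_combination (1 - x) * x ^ 2 * h3 - (1 - x) * (x + x ^ 3) * h4
  have := key (a * Q ^ k)
  rw [← pow_mul, mul_comm 5 k, pow_mul, ← mul_pow, ← this]
  ring

lemma qp_norm5 (z q : ℂ) (hq : ‖q‖ < 1) (hz : IsPrimitiveRoot z 5) :
    qpoch q q * qpoch (z * q) (z * q) * qpoch (z ^ 2 * q) (z ^ 2 * q) *
      qpoch (z ^ 3 * q) (z ^ 3 * q) * qpoch (z ^ 4 * q) (z ^ 4 * q) *
      qpoch (q ^ 25) (q ^ 25) = qpoch (q ^ 5) (q ^ 5) ^ 6 := by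
  have h5 := hz.pow_eq_one
  have hn : ‖z‖ = 1 := hz.norm'_eq_one (by norm_num)
  have hQ : ‖q ^ 5‖ < 1 := norm_pow_lt hq (by norm_num)
  have sp : ∀ c : ℂ, c ^ 5 = 1 → ‖c‖ = 1 → qpoch (c * q) (c * q) =
      qpoch (c * q) (q ^ 5) * qpoch (c ^ 2 * q ^ 2) (q ^ 5) * qpoch (c ^ 3 * q ^ 3) (q ^ 5) *
      qpoch (c ^ 4 * q ^ 4) (q ^ 5) * qpoch (q ^ 5) (q ^ 5) := by
    intro c hc hc1
    rw [qp_split 5 (c * q) (c * q) (by rw [norm_mul, hc1, one_mul]; exact hq)]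
    simp only [Finset.prod_range_succ, Finset.prod_range_zero, one_mul]
    have e : (c * q) ^ 5 = q ^ 5 := by rw [mul_pow, hc, one_mul]
    rw [e, show c * q * (c * q) ^ 4 = q ^ 5 by rw [← e]; ring]
    rw [show c * q * (c * q) ^ 0 = c * q by ring, show c * q * (c * q) ^ 1 = c ^ 2 * q ^ 2 by ring,
      show c * q * (c * q) ^ 2 = c ^ 3 * q ^ 3 by ring,
      show c * q * (c * q) ^ 3 = c ^ 4 * q ^ 4 by ring]
  have s0 := sp 1 (by simp) (by simp)
  have s1 := sp z h5 hn
  have s2 := sp (z ^ 2) (by rw [← pow_mul, mul_comm, pow_mul, h5, one_pow]) (by simp [hn])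
  have s3 := sp (z ^ 3) (by rw [← pow_mul, mul_comm, pow_mul, h5, one_pow]) (by simp [hn])
  have s4 := sp (z ^ 4) (by rw [← pow_mul, mul_comm, pow_mul, h5, one_pow]) (by simp [hn])
  have r1 := qp_root z q (q ^ 5) hQ hz
  have r2 := qp_root (z ^ 2) (q ^ 2) (q ^ 5) hQ (hz.pow_of_coprime 2 (by norm_num))
  have r3 := qp_root (z ^ 3) (q ^ 3) (q ^ 5) hQ (hz.pow_of_coprime 3 (by norm_num))
  have r4 := qp_root (z ^ 4) (q ^ 4) (q ^ 5) hQ (hz.pow_of_coprime 4 (by norm_num))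
  have t := qp_split 5 (q ^ 5) (q ^ 5) hQ
  simp only [Finset.prod_range_succ, Finset.prod_range_zero, one_mul, one_pow, ← pow_mul,
    ← pow_add, mul_one, pow_one, pow_zero] at s0 s1 s2 s3 s4 r1 r2 r3 r4 t ⊢
  norm_num at s0 s1 s2 s3 s4 r1 r2 r3 r4 t ⊢
  rw [s0, s1, s2, s3, s4]
  have t' : qpoch (q ^ 5) (q ^ 5) ^ 6 = qpoch (q ^ 5) (q ^ 25) * qpoch (q ^ 10) (q ^ 25) *
      qpoch (q ^ 15) (q ^ 25) * qpoch (q ^ 20) (q ^ 25) * qpoch (q ^ 25) (q ^ 25) *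
      qpoch (q ^ 5) (q ^ 5) ^ 5 := by rw [← t]; ring
  rw [t', ← r1, ← r2, ← r3, ← r4]
  ring

lemma phi_norm5 (z q : ℂ) (hq : ‖q‖ < 1) (hz : IsPrimitiveRoot z 5) :
    phiNeg q * phiNeg (z * q) * phiNeg (z ^ 2 * q) *
      phiNeg (z ^ 3 * q) * phiNeg (z ^ 4 * q) *
      phiNeg (q ^ 25) = phiNeg (q ^ 5) ^ 6 := by
  have h5 := hz.pow_eq_one
  have n1 := qp_norm5 z q hq hz
  have n2 := qp_norm5 (z ^ 2) (q ^ 2) (norm_pow_lt hq (by norm_num))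
    (hz.pow_of_coprime 2 (by norm_num))
  unfold phiNeg
  simp only [mul_pow, ← pow_mul] at n2 ⊢
  norm_num at n2 ⊢
  rw [div_mul_div_comm, div_mul_div_comm, div_mul_div_comm, div_mul_div_comm, div_mul_div_comm,
    div_pow, ← n2, ← pow_mul, mul_comm 2 6, pow_mul, ← n1]
  ring


open Filter Topology

lemma th_summable (w x : ℂ) (hw0 : w ≠ 0) (hw : ‖w‖ < 1) (hx : x ≠ 0) :
    Summable fun n : ℤ => w ^ (n ^ 2) * x ^ n := by
  have hpi : (Real.pi : ℂ) ≠ 0 := by exact_mod_cast Real.pi_ne_zero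
  have hI := Complex.I_ne_zero
  have h := (summable_jacobiTheta₂_term_iff (Complex.log x / (2 * Real.pi * Complex.I))
    (Complex.log w / (Real.pi * Complex.I))).2 (by
      have : Complex.log w / (Real.pi * Complex.I) =
          ((1 / Real.pi : ℝ) : ℂ) * (-Complex.I * Complex.log w) := by
        push_cast
        field_simp
        rw [Complex.I_sq]; ring
      rw [this, Complex.im_ofReal_mul]
      simp only [Complex.mul_im, Complex.neg_re, Complex.I_re, Complex.neg_im, Complex.I_im,
        Complex.log_re, neg_zero, zero_mul, zero_add]
      have h1 := Real.log_neg (norm_pos_iff.2 hw0) hw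
      have := Real.pi_pos
      have : 0 < 1 / Real.pi := by positivity
      nlinarith)
  refine h.congr (fun n => ?_)
  unfold jacobiTheta₂_term
  rw [show 2 * (Real.pi : ℂ) * Complex.I * n * (Complex.log x / (2 * Real.pi * Complex.I)) +
      Real.pi * Complex.I * n ^ 2 * (Complex.log w / (Real.pi * Complex.I)) =
      ((n ^ 2 : ℤ) : ℂ) * Complex.log w + (n : ℂ) * Complex.log x by
        push_cast; field_simp; ring]
  rw [Complex.exp_add, Complex.exp_int_mul, Complex.exp_int_mul, Complex.exp_log hw0,
    Complex.exp_log hx]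

/-- the theta series `∑ (-1)^n w^(n^2-n) z^n` -/
noncomputable def jj (w z : ℂ) : ℂ := ∑' n : ℤ, (-1) ^ n * w ^ (n ^ 2 - n) * z ^ n

lemma jj_term (w z : ℂ) (hw0 : w ≠ 0) (n : ℤ) :
    (-1) ^ n * w ^ (n ^ 2 - n) * z ^ n = w ^ (n ^ 2) * (-(z / w)) ^ n := by
  rw [zpow_sub₀ hw0, show -(z / w) = (-1) * z * w⁻¹ by field_simp, mul_zpow, mul_zpow, inv_zpow]
  field_simp

lemma jj_summable (w z : ℂ) (hw0 : w ≠ 0) (hw : ‖w‖ < 1) (hz : z ≠ 0) :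
    Summable fun n : ℤ => (-1) ^ n * w ^ (n ^ 2 - n) * z ^ n := by
  simp only [jj_term w z hw0]
  exact th_summable w _ hw0 hw (by simp [hz, hw0])

/-- finite `(p;p)_n` -/
noncomputable def pf (p : ℂ) (n : ℕ) : ℂ := ∏ k ∈ Finset.range n, (1 - p * p ^ k)

/-- reciprocal of `(p;p)_k`, zero for negative `k` -/
noncomputable def rp (p : ℂ) (k : ℤ) : ℂ := if 0 ≤ k then (pf p k.toNat)⁻¹ else 0

lemma one_sub_ne (p : ℂ) (hp : ‖p‖ < 1) (k : ℕ) : 1 - p * p ^ k ≠ 0 := by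
  intro h
  have h1 : p ^ (k + 1) = 1 := by rw [pow_succ]; linear_combination -h
  have := norm_pow_lt hp (n := k + 1) (by omega)
  rw [h1] at this; simp at this

lemma pf_ne (p : ℂ) (hp : ‖p‖ < 1) (n : ℕ) : pf p n ≠ 0 :=
  Finset.prod_ne_zero_iff.2 (fun k _ => one_sub_ne p hp k)

lemma rp_rec (p : ℂ) (hp : ‖p‖ < 1) (k : ℤ) : rp p (k - 1) = (1 - p ^ k) * rp p k := by
  unfold rp
  rcases lt_trichotomy k 0 with h | h | h
  · rw [if_neg (by omega), if_neg (by omega), mul_zero]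
  · subst h; simp
  · obtain ⟨m, rfl⟩ : ∃ m : ℕ, k = m + 1 := ⟨(k - 1).toNat, by omega⟩
    rw [if_pos (by omega), if_pos (by omega)]
    have e1 : ((m : ℤ) + 1 - 1).toNat = m := by omega
    have e2 : ((m : ℤ) + 1).toNat = m + 1 := by omega
    rw [e1, e2]
    have e3 : pf p (m + 1) = pf p m * (1 - p * p ^ m) := Finset.prod_range_succ _ _
    have e4 : p ^ ((m : ℤ) + 1) = p * p ^ m := by
      rw [← pow_succ']; exact_mod_cast rfl
    rw [e3, e4]
    have := pf_ne p hp m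
    have := one_sub_ne p hp m
    field_simp

lemma pf_tendsto (p : ℂ) (hp : ‖p‖ < 1) : Tendsto (pf p) atTop (𝓝 (qpoch p p)) :=
  (qp_mult p p hp).tendsto_prod_tprod_nat

lemma rp_tendsto (p : ℂ) (hp : ‖p‖ < 1) (m : ℤ) :
    Tendsto (fun n : ℕ => rp p (n + m)) atTop (𝓝 (qpoch p p)⁻¹) := by
  have h1 : Tendsto (fun n : ℕ => ((n : ℤ) + m).toNat) atTop atTop := by
    refine tendsto_atTop.2 (fun b => ?_)
    filter_upwards [eventually_ge_atTop (b + m.natAbs)] with n hn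
    omega
  refine (((pf_tendsto p hp).comp h1).inv₀ (qp_ne p p hp hp)).congr' ?_
  filter_upwards [eventually_ge_atTop m.natAbs] with n hn
  unfold rp
  rw [if_pos (by omega)]
  rfl

lemma rp_bdd (p : ℂ) (hp : ‖p‖ < 1) : ∃ C : ℝ, ∀ k : ℤ, ‖rp p k‖ ≤ C := by
  have h := ((pf_tendsto p hp).inv₀ (qp_ne p p hp hp))
  obtain ⟨C, hC⟩ := h.norm.bddAbove_range
  refine ⟨max C 0, fun k => ?_⟩
  unfold rp
  split_ifs
  · exact le_max_of_le_left (hC ⟨k.toNat, rfl⟩)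
  · simp

lemma pf_bdd (p : ℂ) (hp : ‖p‖ < 1) : ∃ C : ℝ, ∀ k : ℕ, ‖pf p k‖ ≤ C := by
  obtain ⟨C, hC⟩ := (pf_tendsto p hp).norm.bddAbove_range
  exact ⟨C, fun k => hC ⟨k, rfl⟩⟩


open Filter Topology

lemma sm_shift1 (f : ℤ → ℂ) (hf : Summable f) : Summable fun m => f (m - 1) :=
  ((Equiv.subRight (1 : ℤ)).summable_iff (f := f)).2 hf

lemma sm_shift2 (f : ℤ → ℂ) (hf : Summable f) : Summable fun m => f (m + 1) :=
  ((Equiv.addRight (1 : ℤ)).summable_iff (f := f)).2 hf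

lemma ts_shift1 (f : ℤ → ℂ) : ∑' m, f (m - 1) = ∑' m, f m := (Equiv.subRight (1 : ℤ)).tsum_eq f

lemma ts_shift2 (f : ℤ → ℂ) : ∑' m, f (m + 1) = ∑' m, f m := (Equiv.addRight (1 : ℤ)).tsum_eq f

lemma jt_summable (w z : ℂ) (hw0 : w ≠ 0) (hw : ‖w‖ < 1) (hz : z ≠ 0) (R : ℤ → ℂ) (C : ℝ)
    (hR : ∀ m, ‖R m‖ ≤ C) :
    Summable fun m : ℤ => ((-1) ^ m * w ^ (m ^ 2 - m) * z ^ m) * R m := by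
  refine Summable.of_norm_bounded ((jj_summable w z hw0 hw hz).norm.mul_right C) (fun m => ?_)
  rw [norm_mul]
  exact mul_le_mul_of_nonneg_left (hR m) (norm_nonneg _)

lemma rp_key (p : ℂ) (hp0 : p ≠ 0) (hp : ‖p‖ < 1) (n : ℕ) (m : ℤ) :
    (1 + p ^ (2 * n + 1)) * (rp p (n - m) * rp p (n + m))
      + p ^ n * p ^ (1 - m) * (rp p (n - (m - 1)) * rp p (n + (m - 1)))
      + p ^ (n + 1) * p ^ m * (rp p (n - (m + 1)) * rp p (n + (m + 1)))
    = (1 - p * p ^ (2 * n)) * (1 - p * p ^ (2 * n + 1)) *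
      (rp p (((n + 1 : ℕ) : ℤ) - m) * rp p (((n + 1 : ℕ) : ℤ) + m)) := by
  set X := rp p (((n + 1 : ℕ) : ℤ) - m) with hX
  set Y := rp p (((n + 1 : ℕ) : ℤ) + m) with hY
  have a1 : rp p (n - m) = (1 - p ^ ((n : ℤ) + 1 - m)) * X := by
    rw [hX, show ((n + 1 : ℕ) : ℤ) - m = (n : ℤ) + 1 - m by push_cast; ring, ← rp_rec p hp]
    congr 1; ring
  have a2 : rp p (n - (m + 1)) = (1 - p ^ ((n : ℤ) - m)) * rp p (n - m) := by
    rw [← rp_rec p hp]; congr 1; ring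
  have a3 : rp p (n - (m - 1)) = X := by
    rw [hX]; congr 1; push_cast; ring
  have b1 : rp p (n + m) = (1 - p ^ ((n : ℤ) + 1 + m)) * Y := by
    rw [hY, show ((n + 1 : ℕ) : ℤ) + m = (n : ℤ) + 1 + m by push_cast; ring, ← rp_rec p hp]
    congr 1; ring
  have b2 : rp p (n + (m - 1)) = (1 - p ^ ((n : ℤ) + m)) * rp p (n + m) := by
    rw [← rp_rec p hp]; congr 1; ring
  have b3 : rp p (n + (m + 1)) = Y := by
    rw [hY]; congr 1; push_cast; ring
  rw [a2, b2, a3, b3, a1, b1]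
  have hm : p ^ m ≠ 0 := zpow_ne_zero _ hp0
  simp only [zpow_add₀ hp0, zpow_sub₀ hp0, zpow_natCast, zpow_one]
  field_simp
  ring

lemma t_shift1 (w z : ℂ) (hw0 : w ≠ 0) (hz : z ≠ 0) (m : ℤ) :
    z * ((-1) ^ (m - 1) * w ^ ((m - 1) ^ 2 - (m - 1)) * z ^ (m - 1))
      = -(((-1) ^ m * w ^ (m ^ 2 - m) * z ^ m) * (w ^ 2) ^ (1 - m)) := by
  have : (w ^ 2) ^ (1 - m) = w ^ (2 * (1 - m)) := by rw [zpow_mul]; norm_cast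
  rw [this, show (m - 1) ^ 2 - (m - 1) = (m ^ 2 - m) + 2 * (1 - m) by ring, zpow_add₀ hw0,
    zpow_sub₀ hz, zpow_sub₀ (by norm_num)]
  field_simp

lemma t_shift2 (w z : ℂ) (hw0 : w ≠ 0) (hz : z ≠ 0) (m : ℤ) :
    z⁻¹ * ((-1) ^ (m + 1) * w ^ ((m + 1) ^ 2 - (m + 1)) * z ^ (m + 1))
      = -(((-1) ^ m * w ^ (m ^ 2 - m) * z ^ m) * (w ^ 2) ^ m) := by
  have : (w ^ 2) ^ m = w ^ (2 * m) := by rw [zpow_mul]; norm_cast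
  rw [this, show (m + 1) ^ 2 - (m + 1) = (m ^ 2 - m) + 2 * m by ring, zpow_add₀ hw0,
    zpow_add₀ hz, zpow_add₀ (by norm_num)]
  field_simp

lemma finite_jtp (w z : ℂ) (hw0 : w ≠ 0) (hw : ‖w‖ < 1) (hz : z ≠ 0) (n : ℕ) :
    (∏ k ∈ Finset.range n, (1 - z * (w ^ 2) ^ k)) *
      (∏ k ∈ Finset.range n, (1 - w ^ 2 / z * (w ^ 2) ^ k)) =
    pf (w ^ 2) (2 * n) * ∑' m : ℤ, ((-1) ^ m * w ^ (m ^ 2 - m) * z ^ m) *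
      (rp (w ^ 2) (n - m) * rp (w ^ 2) (n + m)) := by
  have hp : ‖w ^ 2‖ < 1 := norm_pow_lt hw (by norm_num)
  have hp0 : w ^ 2 ≠ 0 := pow_ne_zero _ hw0
  obtain ⟨C, hC⟩ := rp_bdd (w ^ 2) hp
  have hC0 : 0 ≤ C := (norm_nonneg _).trans (hC 0)
  have hb : ∀ (a b : ℤ), ‖rp (w ^ 2) a * rp (w ^ 2) b‖ ≤ C * C := by
    intro a b
    rw [norm_mul]
    exact mul_le_mul (hC a) (hC b) (norm_nonneg _) hC0
  induction n with
  | zero =>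
    rw [tsum_eq_single 0]
    · simp [pf, rp]
    · intro m hm
      have : rp (w ^ 2) ((0 : ℕ) - m) * rp (w ^ 2) ((0 : ℕ) + m) = 0 := by
        unfold rp
        rcases lt_or_gt_of_ne hm with h | h
        · rw [if_neg (c := 0 ≤ ((0 : ℕ) : ℤ) + m) (by push_cast; omega), mul_zero]
        · rw [if_neg (c := 0 ≤ ((0 : ℕ) : ℤ) - m) (by push_cast; omega), zero_mul]
      rw [this, mul_zero]
  | succ n ih =>
    rw [Finset.prod_range_succ, Finset.prod_range_succ]
    have e3 : pf (w ^ 2) (2 * (n + 1)) = pf (w ^ 2) (2 * n) *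
        ((1 - w ^ 2 * (w ^ 2) ^ (2 * n)) * (1 - w ^ 2 * (w ^ 2) ^ (2 * n + 1))) := by
      unfold pf
      rw [show 2 * (n + 1) = 2 * n + 1 + 1 by ring, Finset.prod_range_succ,
        Finset.prod_range_succ]
      ring
    have hs := jt_summable w z hw0 hw hz (fun m => rp (w ^ 2) (n - m) * rp (w ^ 2) (n + m)) _
      (fun m => hb _ _)
    set f : ℤ → ℂ := fun m => ((-1) ^ m * w ^ (m ^ 2 - m) * z ^ m) *
      (rp (w ^ 2) (n - m) * rp (w ^ 2) (n + m)) with hf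
    have s1 : ∑' m, f (m - 1) = ∑' m, f m := ts_shift1 f
    have s2 : ∑' m, f (m + 1) = ∑' m, f m := ts_shift2 f
    have hs1 : Summable fun m => f (m - 1) := sm_shift1 f hs
    have hs2 : Summable fun m => f (m + 1) := sm_shift2 f hs
    have main : (1 + (w ^ 2) ^ (2 * n + 1)) * ∑' m, f m - (w ^ 2) ^ n * z * ∑' m, f m
        - (w ^ 2) ^ (n + 1) * z⁻¹ * ∑' m, f m =
        ((1 - w ^ 2 * (w ^ 2) ^ (2 * n)) * (1 - w ^ 2 * (w ^ 2) ^ (2 * n + 1))) *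
        ∑' m : ℤ, ((-1) ^ m * w ^ (m ^ 2 - m) * z ^ m) *
      (rp (w ^ 2) ((n + 1 : ℕ) - m) * rp (w ^ 2) ((n + 1 : ℕ) + m)) := by
      conv_lhs =>
        congr
        · congr
          · skip
          · rw [← s1]
        · rw [← s2]
      rw [← tsum_mul_left, ← tsum_mul_left, ← tsum_mul_left, ← tsum_mul_left,
        ← (hs.mul_left _).tsum_sub (hs1.mul_left _),
        ← ((hs.mul_left _).sub (hs1.mul_left _)).tsum_sub (hs2.mul_left _)]
      refine tsum_congr (fun m => ?_)
      have k := rp_key (w ^ 2) hp0 hp n m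
      have k1 := t_shift1 w z hw0 hz m
      have k2 := t_shift2 w z hw0 hz m
      simp only [hf]
      linear_combination ((-1) ^ m * w ^ (m ^ 2 - m) * z ^ m) * k
        - (w ^ 2) ^ n * (rp (w ^ 2) (n - (m - 1)) * rp (w ^ 2) (n + (m - 1))) * k1
        - (w ^ 2) ^ (n + 1) * (rp (w ^ 2) (n - (m + 1)) * rp (w ^ 2) (n + (m + 1))) * k2
    rw [e3]
    rw [mul_assoc (pf _ _), ← main]
    have hzz : z * z⁻¹ = 1 := mul_inv_cancel₀ hz
    rw [div_eq_mul_inv] at ih ⊢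
    linear_combination (1 - z * (w ^ 2) ^ n) * (1 - w ^ 2 * z⁻¹ * (w ^ 2) ^ n) * ih +
      pf (w ^ 2) (2 * n) * (∑' m, f m) * (w ^ 2) ^ (2 * n + 1) * hzz

theorem jtp (w z : ℂ) (hw0 : w ≠ 0) (hw : ‖w‖ < 1) (hz : z ≠ 0) :
    jj w z = qpoch z (w ^ 2) * qpoch (w ^ 2 / z) (w ^ 2) * qpoch (w ^ 2) (w ^ 2) := by
  have hp : ‖w ^ 2‖ < 1 := norm_pow_lt hw (by norm_num)
  have hE := qp_ne _ _ hp hp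
  obtain ⟨C, hC⟩ := rp_bdd (w ^ 2) hp
  have hC0 : 0 ≤ C := (norm_nonneg _).trans (hC 0)
  have L : Tendsto (fun n : ℕ => (∏ k ∈ Finset.range n, (1 - z * (w ^ 2) ^ k)) *
      (∏ k ∈ Finset.range n, (1 - w ^ 2 / z * (w ^ 2) ^ k))) atTop
      (𝓝 (qpoch z (w ^ 2) * qpoch (w ^ 2 / z) (w ^ 2))) :=
    ((qp_mult z _ hp).tendsto_prod_tprod_nat).mul ((qp_mult _ _ hp).tendsto_prod_tprod_nat)
  have R1 : Tendsto (fun n : ℕ => ∑' m : ℤ, ((-1) ^ m * w ^ (m ^ 2 - m) * z ^ m) *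
      (rp (w ^ 2) (n - m) * rp (w ^ 2) (n + m))) atTop
      (𝓝 (∑' m : ℤ, ((-1) ^ m * w ^ (m ^ 2 - m) * z ^ m) *
        ((qpoch (w ^ 2) (w ^ 2))⁻¹ * (qpoch (w ^ 2) (w ^ 2))⁻¹))) := by
    refine tendsto_tsum_of_dominated_convergence
      ((jj_summable w z hw0 hw hz).norm.mul_right (C * C)) ?_ ?_
    · intro m
      refine Tendsto.const_mul _ (Tendsto.mul ?_ (rp_tendsto _ hp m))
      simpa [sub_eq_add_neg] using rp_tendsto _ hp (-m)
    · refine Eventually.of_forall (fun n m => ?_)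
      rw [norm_mul, norm_mul (rp _ _)]
      exact mul_le_mul_of_nonneg_left (mul_le_mul (hC _) (hC _) (norm_nonneg _) hC0)
        (norm_nonneg _)
  have R2 : Tendsto (fun n : ℕ => pf (w ^ 2) (2 * n)) atTop (𝓝 (qpoch (w ^ 2) (w ^ 2))) :=
    (pf_tendsto _ hp).comp (tendsto_id.const_mul_atTop' (by norm_num))
  have key := tendsto_nhds_unique L ((R2.mul R1).congr (fun n => (finite_jtp w z hw0 hw hz n).symm))
  rw [tsum_mul_right] at key
  rw [key]
  unfold jj
  field_simp


lemma split2 (F : ℤ × ℤ → ℂ) (hF : Summable F) (e1 e2 : ℤ × ℤ → ℤ × ℤ)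
    (h : Function.Bijective (Sum.elim e1 e2)) :
    Summable (fun p => F (e1 p)) ∧ Summable (fun p => F (e2 p)) ∧
    ∑' p, F p = ∑' p, F (e1 p) + ∑' p, F (e2 p) := by
  have i1 : Function.Injective e1 := h.1.comp Sum.inl_injective
  have i2 : Function.Injective e2 := h.1.comp Sum.inr_injective
  have s1 : Summable (fun p => F (e1 p)) := hF.comp_injective i1
  have s2 : Summable (fun p => F (e2 p)) := hF.comp_injective i2
  refine ⟨s1, s2, ?_⟩
  rw [← (Equiv.ofBijective _ h).tsum_eq F]
  exact Summable.tsum_sum (f := fun x => F (Equiv.ofBijective _ h x)) s1 s2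

lemma mul_pr (f g : ℤ → ℂ) (hf : Summable f) (hg : Summable g) :
    Summable (fun p : ℤ × ℤ => f p.1 * g p.2) ∧
    (∑' n, f n) * (∑' n, g n) = ∑' p : ℤ × ℤ, f p.1 * g p.2 :=
  ⟨summable_mul_of_summable_norm hf.norm hg.norm, tsum_mul_tsum_of_summable_norm hf.norm hg.norm⟩

lemma jj_mul (w v x y : ℂ) (hw0 : w ≠ 0) (hw : ‖w‖ < 1) (hv0 : v ≠ 0) (hv : ‖v‖ < 1)
    (hx : x ≠ 0) (hy : y ≠ 0) :
    Summable (fun p : ℤ × ℤ => ((-1) ^ p.1 * w ^ (p.1 ^ 2 - p.1) * x ^ p.1) *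
      ((-1) ^ p.2 * v ^ (p.2 ^ 2 - p.2) * y ^ p.2)) ∧
    jj w x * jj v y = ∑' p : ℤ × ℤ, ((-1) ^ p.1 * w ^ (p.1 ^ 2 - p.1) * x ^ p.1) *
      ((-1) ^ p.2 * v ^ (p.2 ^ 2 - p.2) * y ^ p.2) := by
  exact mul_pr (fun n : ℤ => (-1) ^ n * w ^ (n ^ 2 - n) * x ^ n)
    (fun n : ℤ => (-1) ^ n * v ^ (n ^ 2 - n) * y ^ n)
    (jj_summable w x hw0 hw hx) (jj_summable v y hv0 hv hy)

noncomputable def tA (w x : ℂ) : ℂ := ∑' k : ℤ, w ^ (2 * k ^ 2) * x ^ (2 * k)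
noncomputable def tB (w x : ℂ) : ℂ := ∑' k : ℤ, w ^ (2 * k ^ 2 - 2 * k) * x ^ (2 * k - 1)

lemma tA_sum (w x : ℂ) (hw0 : w ≠ 0) (hw : ‖w‖ < 1) (hx : x ≠ 0) :
    Summable fun k : ℤ => w ^ (2 * k ^ 2) * x ^ (2 * k) := by
  refine (th_summable (w ^ 2) (x ^ 2) (pow_ne_zero _ hw0) (norm_pow_lt hw (by norm_num))
    (pow_ne_zero _ hx)).congr (fun k => ?_)
  rw [zpow_mul, zpow_mul]; norm_cast

lemma tB_sum (w x : ℂ) (hw0 : w ≠ 0) (hw : ‖w‖ < 1) (hx : x ≠ 0) :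
    Summable fun k : ℤ => w ^ (2 * k ^ 2 - 2 * k) * x ^ (2 * k - 1) := by
  refine ((tA_sum w (x / w) hw0 hw (div_ne_zero hx hw0)).mul_right x⁻¹).congr (fun k => ?_)
  rw [div_zpow, zpow_sub₀ hw0, zpow_sub₀ hx]
  field_simp

lemma tB_eq (w x : ℂ) : tB w x = ∑' k : ℤ, w ^ (2 * k ^ 2 + 2 * k) * x ^ (2 * k + 1) := by
  unfold tB
  rw [← ts_shift2]
  refine tsum_congr (fun k => ?_)
  congr 2 <;> ring

lemma jj_prod_term (w X Y : ℂ) (hw0 : w ≠ 0) (hX : X ≠ 0) (hY : Y ≠ 0) (m n : ℤ) :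
    ((-1) ^ m * w ^ (m ^ 2 - m) * (X * Y) ^ m) * ((-1) ^ n * w ^ (n ^ 2 - n) * (X / Y) ^ n)
    = (-1) ^ (m + n) * w ^ (m ^ 2 - m + (n ^ 2 - n)) * X ^ (m + n) * Y ^ (m - n) := by
  rw [zpow_add₀ (by norm_num), zpow_add₀ hw0, zpow_add₀ hX, zpow_sub₀ hY, mul_zpow, div_zpow]
  field_simp

theorem pluck (w X Y : ℂ) (hw0 : w ≠ 0) (hw : ‖w‖ < 1) (hX : X ≠ 0) (hY : Y ≠ 0) :
    jj w (X * Y) * jj w (X / Y) = X * (tB w X * tA w Y - tA w X * tB w Y) := by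
  obtain ⟨hs, he⟩ := jj_mul w w (X * Y) (X / Y) hw0 hw hw0 hw (mul_ne_zero hX hY)
    (div_ne_zero hX hY)
  obtain ⟨s1, s2, e⟩ := split2 _ hs (fun p => (p.1 + p.2, p.1 - p.2))
    (fun p => (p.1 + p.2 + 1, p.1 - p.2)) (by
      constructor
      · rintro (⟨a, b⟩ | ⟨a, b⟩) (⟨c, d⟩ | ⟨c, d⟩) h <;>
          simp only [Sum.elim_inl, Sum.elim_inr, Prod.mk.injEq] at h <;>
          first
          | (exfalso; omega)
          | (congr 2 <;> omega)
      · rintro ⟨m, n⟩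
        rcases Int.even_or_odd' (m + n) with ⟨k, hk | hk⟩
        · exact ⟨Sum.inl (k, m - k), by simp; omega⟩
        · exact ⟨Sum.inr (k, m - k - 1), by simp; omega⟩)
  rw [he, e]
  simp only [jj_prod_term w X Y hw0 hX hY]
  have f1 : ∀ p : ℤ × ℤ, (-1 : ℂ) ^ (p.1 + p.2 + (p.1 - p.2)) *
      w ^ ((p.1 + p.2) ^ 2 - (p.1 + p.2) + ((p.1 - p.2) ^ 2 - (p.1 - p.2))) *
      X ^ (p.1 + p.2 + (p.1 - p.2)) * Y ^ (p.1 + p.2 - (p.1 - p.2))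
      = X * ((w ^ (2 * p.1 ^ 2 - 2 * p.1) * X ^ (2 * p.1 - 1)) *
        (w ^ (2 * p.2 ^ 2) * Y ^ (2 * p.2))) := by
    rintro ⟨k, l⟩
    dsimp only
    rw [Even.neg_one_zpow ⟨k, by ring⟩,
      show (k + l) ^ 2 - (k + l) + ((k - l) ^ 2 - (k - l)) = (2 * k ^ 2 - 2 * k) + 2 * l ^ 2 by ring,
      zpow_add₀ hw0, show k + l + (k - l) = 2 * k - 1 + 1 by ring, zpow_add₀ hX,
      show k + l - (k - l) = 2 * l by ring, zpow_one]
    ring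
  have f2 : ∀ p : ℤ × ℤ, (-1 : ℂ) ^ (p.1 + p.2 + 1 + (p.1 - p.2)) *
      w ^ ((p.1 + p.2 + 1) ^ 2 - (p.1 + p.2 + 1) + ((p.1 - p.2) ^ 2 - (p.1 - p.2))) *
      X ^ (p.1 + p.2 + 1 + (p.1 - p.2)) * Y ^ (p.1 + p.2 + 1 - (p.1 - p.2))
      = -X * ((w ^ (2 * p.1 ^ 2) * X ^ (2 * p.1)) *
        (w ^ (2 * p.2 ^ 2 + 2 * p.2) * Y ^ (2 * p.2 + 1))) := by
    rintro ⟨k, l⟩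
    dsimp only
    rw [Odd.neg_one_zpow ⟨k, by ring⟩,
      show (k + l + 1) ^ 2 - (k + l + 1) + ((k - l) ^ 2 - (k - l))
        = (2 * k ^ 2) + (2 * l ^ 2 + 2 * l) by ring,
      zpow_add₀ hw0, show k + l + 1 + (k - l) = 2 * k + 1 by ring, zpow_add₀ hX,
      show k + l + 1 - (k - l) = 2 * l + 1 by ring, zpow_one]
    ring
  simp only [f1, f2]
  have sB : Summable fun k : ℤ => w ^ (2 * k ^ 2 + 2 * k) * Y ^ (2 * k + 1) := by
    refine (sm_shift2 _ (tB_sum w Y hw0 hw hY)).congr (fun k => ?_)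
    congr 2 <;> ring
  rw [tsum_mul_left, tsum_mul_left,
    ← tsum_mul_tsum_of_summable_norm (tB_sum w X hw0 hw hX).norm (tA_sum w Y hw0 hw hY).norm,
    ← tsum_mul_tsum_of_summable_norm (tA_sum w X hw0 hw hX).norm sB.norm, ← tB_eq]
  unfold tA tB
  ring

theorem qpi (w z : ℂ) (hw0 : w ≠ 0) (hw : ‖w‖ < 1) (hz : z ≠ 0) :
    (jj (w ^ 3) (w ^ 2 * z ^ 3) + z * jj (w ^ 3) (w ^ 4 * z ^ 3)) * jj w z
      = jj (w ^ 3) (w ^ 2) * jj w (z ^ 2) := by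
  have h30 : w ^ 3 ≠ 0 := pow_ne_zero _ hw0
  have h3 : ‖w ^ 3‖ < 1 := norm_pow_lt hw (by norm_num)
  have hz3 : z ^ 3 ≠ 0 := pow_ne_zero _ hz
  obtain ⟨sA, eA⟩ := jj_mul (w ^ 3) w (w ^ 2 * z ^ 3) z h30 h3 hw0 hw
    (mul_ne_zero (pow_ne_zero _ hw0) hz3) hz
  obtain ⟨sB, eB⟩ := jj_mul (w ^ 3) w (w ^ 4 * z ^ 3) z h30 h3 hw0 hw
    (mul_ne_zero (pow_ne_zero _ hw0) hz3) hz
  obtain ⟨sC, eC⟩ := jj_mul (w ^ 3) w (w ^ 2) (z ^ 2) h30 h3 hw0 hw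
    (pow_ne_zero _ hw0) (pow_ne_zero _ hz)
  obtain ⟨-, -, dA⟩ := split2 _ sA (fun p => (p.1, 2 * p.2 - 3 * p.1))
    (fun p => (p.1, 2 * p.2 + 1 - 3 * p.1)) (by
      constructor
      · rintro (⟨a, b⟩ | ⟨a, b⟩) (⟨c, d⟩ | ⟨c, d⟩) h <;>
          simp only [Sum.elim_inl, Sum.elim_inr, Prod.mk.injEq] at h <;>
          first
          | (exfalso; omega)
          | (congr 2 <;> omega)
      · rintro ⟨m, n⟩
        rcases Int.even_or_odd' (n + 3 * m) with ⟨k, hk | hk⟩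
        · exact ⟨Sum.inl (m, k), by simp; omega⟩
        · exact ⟨Sum.inr (m, k), by simp; omega⟩)
  obtain ⟨-, -, dB⟩ := split2 _ sB (fun p => (p.2 - 1 - p.1, 3 * p.1 + 2 - p.2))
    (fun p => (p.2 - p.1, 3 * p.1 - p.2)) (by
      constructor
      · rintro (⟨a, b⟩ | ⟨a, b⟩) (⟨c, d⟩ | ⟨c, d⟩) h <;>
          simp only [Sum.elim_inl, Sum.elim_inr, Prod.mk.injEq] at h <;>
          first
          | (exfalso; omega)
          | (congr 2 <;> omega)
      · rintro ⟨m, n⟩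
        rcases Int.even_or_odd' (m + n) with ⟨k, hk | hk⟩
        · exact ⟨Sum.inr (k, m + k), by simp; omega⟩
        · exact ⟨Sum.inl (k, m + 1 + k), by simp; omega⟩)
  obtain ⟨-, -, dC⟩ := split2 _ sC (fun p => (p.2 - 2 * p.1, p.2))
    (fun p => (p.2 - 1 - 2 * p.1, p.2)) (by
      constructor
      · rintro (⟨a, b⟩ | ⟨a, b⟩) (⟨c, d⟩ | ⟨c, d⟩) h <;>
          simp only [Sum.elim_inl, Sum.elim_inr, Prod.mk.injEq] at h <;>
          first
          | (exfalso; omega)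
          | (congr 2 <;> omega)
      · rintro ⟨m, n⟩
        rcases Int.even_or_odd' (n - m) with ⟨k, hk | hk⟩
        · exact ⟨Sum.inl (k, n), by simp; omega⟩
        · exact ⟨Sum.inr (k, n), by simp; omega⟩)
  have tm : ∀ (c d e : ℕ) (n m : ℤ), ((-1) ^ n * (w ^ 3) ^ (n ^ 2 - n) * (w ^ c * z ^ d) ^ n) *
      ((-1) ^ m * w ^ (m ^ 2 - m) * (z ^ e) ^ m)
      = (-1) ^ (n + m) * w ^ (3 * (n ^ 2 - n) + c * n + (m ^ 2 - m)) * z ^ (d * n + e * m) := by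
    intro c d e n m
    rw [zpow_add₀ (by norm_num), zpow_add₀ hw0, zpow_add₀ hw0, zpow_add₀ hz, mul_zpow, zpow_mul,
      zpow_mul, zpow_mul, zpow_mul]
    norm_cast
    ring
  have tA := tm 2 3 1
  have tB := tm 4 3 1
  have tC := tm 2 0 2
  simp only [pow_one, pow_zero, mul_one] at tA tB tC
  simp only [tA] at dA eA
  simp only [tB] at dB eB
  simp only [tC] at dC eC
  rw [add_mul, mul_assoc, eA, eB, eC, dA, dB, dC, mul_add, ← tsum_mul_left, ← tsum_mul_left]
  have g1 : ∀ a b c a' b' c' : ℤ, Even (a - a') → b = b' → c = c' →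
      (-1 : ℂ) ^ a * w ^ b * z ^ c = (-1) ^ a' * w ^ b' * z ^ c' := by
    rintro a b c a' b' c' ⟨k, hk⟩ rfl rfl
    rw [show a = a' + 2 * k by omega, zpow_add₀ (by norm_num), Even.neg_one_zpow (n := 2 * k) ⟨k, by ring⟩]
    ring
  have g2 : ∀ a b c a' b' c' : ℤ, Even (a - a') → b = b' → c + 1 = c' →
      z * ((-1 : ℂ) ^ a * w ^ b * z ^ c) = (-1) ^ a' * w ^ b' * z ^ c' := by
    rintro a b c a' b' c' h hb hc
    rw [← g1 a b (c + 1) a' b' c' h hb hc, zpow_add₀ hz, zpow_one]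
    ring
  have g3 : ∀ a b c a' b' c' : ℤ, Odd (a - a') → b = b' → c + 1 = c' →
      z * ((-1 : ℂ) ^ a * w ^ b * z ^ c) = - ((-1) ^ a' * w ^ b' * z ^ c') := by
    rintro a b c a' b' c' ⟨k, hk⟩ hb hc
    rw [g2 a b c (a' + 1) b' c' ⟨k, by omega⟩ hb hc, zpow_add₀ (by norm_num)]
    simp
  have m1 : ∀ p : ℤ × ℤ, _ := fun p : ℤ × ℤ => g1 (p.1 + (2 * p.2 - 3 * p.1)) (3 * (p.1 ^ 2 - p.1) + (2 : ℕ) * p.1 +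
    ((2 * p.2 - 3 * p.1) ^ 2 - (2 * p.2 - 3 * p.1))) ((3 : ℕ) * p.1 + (1 : ℕ) * (2 * p.2 - 3 * p.1))
    ((p.2 - 2 * p.1) + p.2) (3 * ((p.2 - 2 * p.1) ^ 2 - (p.2 - 2 * p.1)) +
      (2 : ℕ) * (p.2 - 2 * p.1) + (p.2 ^ 2 - p.2)) ((0 : ℕ) * (p.2 - 2 * p.1) + (2 : ℕ) * p.2)
      ⟨0, by ring⟩ (by push_cast; ring) (by push_cast; ring)
  have m2 : ∀ p : ℤ × ℤ, _ := fun p : ℤ × ℤ => g2 ((p.2 - 1 - p.1) + (3 * p.1 + 2 - p.2))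
    (3 * ((p.2 - 1 - p.1) ^ 2 - (p.2 - 1 - p.1)) + (4 : ℕ) * (p.2 - 1 - p.1) +
    ((3 * p.1 + 2 - p.2) ^ 2 - (3 * p.1 + 2 - p.2)))
    ((3 : ℕ) * (p.2 - 1 - p.1) + (1 : ℕ) * (3 * p.1 + 2 - p.2))
    ((p.2 - 1 - 2 * p.1) + p.2) (3 * ((p.2 - 1 - 2 * p.1) ^ 2 - (p.2 - 1 - 2 * p.1)) +
      (2 : ℕ) * (p.2 - 1 - 2 * p.1) + (p.2 ^ 2 - p.2)) ((0 : ℕ) * (p.2 - 1 - 2 * p.1) + (2 : ℕ) * p.2)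
      ⟨2 * p.1 - p.2 + 1, by ring⟩ (by push_cast; ring) (by push_cast; ring)
  have m3 : ∀ p : ℤ × ℤ, _ := fun p : ℤ × ℤ => g3 ((p.2 - p.1) + (3 * p.1 - p.2))
    (3 * ((p.2 - p.1) ^ 2 - (p.2 - p.1)) + (4 : ℕ) * (p.2 - p.1) +
    ((3 * p.1 - p.2) ^ 2 - (3 * p.1 - p.2)))
    ((3 : ℕ) * (p.2 - p.1) + (1 : ℕ) * (3 * p.1 - p.2))
    (p.1 + (2 * p.2 + 1 - 3 * p.1)) (3 * (p.1 ^ 2 - p.1) + (2 : ℕ) * p.1 +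
    ((2 * p.2 + 1 - 3 * p.1) ^ 2 - (2 * p.2 + 1 - 3 * p.1)))
    ((3 : ℕ) * p.1 + (1 : ℕ) * (2 * p.2 + 1 - 3 * p.1))
      ⟨2 * p.1 - p.2 - 1, by ring⟩ (by push_cast; ring) (by push_cast; ring)
  rw [tsum_congr m1, tsum_congr m2, tsum_congr m3, tsum_neg]
  ring


lemma jj_symm (w z : ℂ) (hw0 : w ≠ 0) (hw : ‖w‖ < 1) (hz : z ≠ 0) : jj w (w ^ 2 / z) = jj w z := by
  have h2 : w ^ 2 ≠ 0 := pow_ne_zero _ hw0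
  rw [jtp w z hw0 hw hz, jtp w (w ^ 2 / z) hw0 hw (div_ne_zero h2 hz),
    show w ^ 2 / (w ^ 2 / z) = z by field_simp]
  ring

lemma jj_symm' (w z z' : ℂ) (hw0 : w ≠ 0) (hw : ‖w‖ < 1) (hz : z ≠ 0) (h : z * z' = w ^ 2) :
    jj w z' = jj w z := by
  rw [← jj_symm w z hw0 hw hz, ← h]
  congr 1
  field_simp

lemma jj_shift (w z : ℂ) (hw0 : w ≠ 0) (hz : z ≠ 0) :
    jj w (w ^ 2 * z) = - (z⁻¹ * jj w z) := by
  unfold jj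
  rw [← ts_shift2 (fun n : ℤ => (-1) ^ n * w ^ (n ^ 2 - n) * z ^ n), ← tsum_mul_left, ← tsum_neg]
  refine tsum_congr (fun m => ?_)
  rw [t_shift2 w z hw0 hz, mul_zpow]
  ring

lemma J64 (q : ℂ) (hq0 : q ≠ 0) (hq : ‖q‖ < 1) : jj (q ^ 5) (q ^ 6) = jj (q ^ 5) (q ^ 4) :=
  jj_symm' _ _ _ (pow_ne_zero _ hq0) (norm_pow_lt hq (by norm_num)) (pow_ne_zero _ hq0) (by ring)
lemma J73 (q : ℂ) (hq0 : q ≠ 0) (hq : ‖q‖ < 1) : jj (q ^ 5) (q ^ 7) = jj (q ^ 5) (q ^ 3) :=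
  jj_symm' _ _ _ (pow_ne_zero _ hq0) (norm_pow_lt hq (by norm_num)) (pow_ne_zero _ hq0) (by ring)
lemma J91 (q : ℂ) (hq0 : q ≠ 0) (hq : ‖q‖ < 1) : jj (q ^ 5) (q ^ 9) = jj (q ^ 5) q :=
  jj_symm' _ _ _ (pow_ne_zero _ hq0) (norm_pow_lt hq (by norm_num)) hq0 (by ring)

lemma pl_nat (q : ℂ) (hq0 : q ≠ 0) (hq : ‖q‖ < 1) (a b s d : ℕ) (hs : s = a + b) (hd : a = d + b) :
    jj (q ^ 5) (q ^ s) * jj (q ^ 5) (q ^ d) = q ^ a *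
      (tB (q ^ 5) (q ^ a) * tA (q ^ 5) (q ^ b) - tA (q ^ 5) (q ^ a) * tB (q ^ 5) (q ^ b)) := by
  rw [← pluck (q ^ 5) (q ^ a) (q ^ b) (pow_ne_zero _ hq0) (norm_pow_lt hq (by norm_num))
    (pow_ne_zero _ hq0) (pow_ne_zero _ hq0)]
  congr 2
  · rw [hs, pow_add]
  · have := pow_ne_zero b hq0
    rw [hd, pow_add]; field_simp

lemma h421 (q : ℂ) (hq0 : q ≠ 0) (hq : ‖q‖ < 1) : q * jj (q ^ 5) (q ^ 4) * jj (q ^ 5) (q ^ 2) * jj (q ^ 5) q ^ 2 =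
    jj (q ^ 5) (q ^ 5) * jj (q ^ 5) (q ^ 3) * jj (q ^ 5) (q ^ 2) ^ 2
      - jj (q ^ 5) (q ^ 4) ^ 2 * jj (q ^ 5) (q ^ 3) * jj (q ^ 5) q := by
  have p42 := pl_nat q hq0 hq 4 2 6 2 rfl rfl
  have p41 := pl_nat q hq0 hq 4 1 5 3 rfl rfl
  have p21 := pl_nat q hq0 hq 2 1 3 1 rfl rfl
  have p40 := pl_nat q hq0 hq 4 0 4 4 rfl rfl
  have p20 := pl_nat q hq0 hq 2 0 2 2 rfl rfl
  have p10 := pl_nat q hq0 hq 1 0 1 1 rfl rfl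
  rw [J64 q hq0 hq] at p42
  rw [pow_one] at p10 p21 p41
  calc _ = q * (jj (q ^ 5) (q ^ 4) * jj (q ^ 5) (q ^ 2)) * (jj (q ^ 5) q * jj (q ^ 5) q) := by ring
    _ = (jj (q ^ 5) (q ^ 5) * jj (q ^ 5) (q ^ 3)) * (jj (q ^ 5) (q ^ 2) * jj (q ^ 5) (q ^ 2))
      - (jj (q ^ 5) (q ^ 4) * jj (q ^ 5) (q ^ 4)) * (jj (q ^ 5) (q ^ 3) * jj (q ^ 5) q) := by
        rw [p42, p41, p21, p40, p20, p10]; ring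
    _ = _ := by ring

lemma h432 (q : ℂ) (hq0 : q ≠ 0) (hq : ‖q‖ < 1) : q * jj (q ^ 5) (q ^ 3) * jj (q ^ 5) q * jj (q ^ 5) (q ^ 2) ^ 2 =
    jj (q ^ 5) (q ^ 4) * jj (q ^ 5) (q ^ 2) * jj (q ^ 5) (q ^ 3) ^ 2
      - jj (q ^ 5) (q ^ 4) ^ 2 * jj (q ^ 5) (q ^ 5) * jj (q ^ 5) q := by
  have p43 := pl_nat q hq0 hq 4 3 7 1 rfl rfl
  have p42 := pl_nat q hq0 hq 4 2 6 2 rfl rfl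
  have p32 := pl_nat q hq0 hq 3 2 5 1 rfl rfl
  have p40 := pl_nat q hq0 hq 4 0 4 4 rfl rfl
  have p20 := pl_nat q hq0 hq 2 0 2 2 rfl rfl
  have p30 := pl_nat q hq0 hq 3 0 3 3 rfl rfl
  rw [J64 q hq0 hq] at p42
  rw [J73 q hq0 hq] at p43
  rw [pow_one] at p43 p32
  calc _ = q * (jj (q ^ 5) (q ^ 3) * jj (q ^ 5) q) * (jj (q ^ 5) (q ^ 2) * jj (q ^ 5) (q ^ 2)) := by ring
    _ = (jj (q ^ 5) (q ^ 4) * jj (q ^ 5) (q ^ 2)) * (jj (q ^ 5) (q ^ 3) * jj (q ^ 5) (q ^ 3))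
      - (jj (q ^ 5) (q ^ 4) * jj (q ^ 5) (q ^ 4)) * (jj (q ^ 5) (q ^ 5) * jj (q ^ 5) q) := by
        rw [p43, p42, p32, p40, p20, p30]; ring
    _ = _ := by ring

lemma poly_target (q J1 J2 J3 J4 J5 : ℂ) (h1 : q * J4 * J2 * J1 ^ 2 = J5 * J3 * J2 ^ 2 - J4 ^ 2 * J3 * J1)
    (h2 : q * J3 * J1 * J2 ^ 2 = J4 * J2 * J3 ^ 2 - J4 ^ 2 * J5 * J1) :
    J1^2*J2^2*J3*J4^3*(J5^2*J3^2 - 2*q^2*J5*J1^3 + 4*q*J3^3*J1)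
      = J5^2*(J2^5*J3^5 + 2*q*J1^5*J4^5) := by
  linear_combination (-2*q*J1^4*J4^3*J5 - q*J1^3*J2*J3^2*J4^2 + J1^2*J3^3*J4^3)*h2 + (-J1^2*J3^2*J4^3*J5 + J1*J2*J3^4*J4^2 + q*J1^2*J2^2*J3^3*J4 + J2^3*J3^4*J5)*h1

lemma ts_mod5 (f : ℤ → ℂ) (hf : Summable f) :
    ∑' n, f n = ∑' m, f (5 * m) + ∑' m, f (5 * m + 1) + ∑' m, f (5 * m + 2)
      + ∑' m, f (5 * m - 1) + ∑' m, f (5 * m - 2) := by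
  have e2 := (((Equiv.prodComm (Fin 5) ℤ).trans (Int.divModEquiv 5).symm).summable_iff
    (f := f)).2 hf
  have e1 := ((Equiv.prodComm (Fin 5) ℤ).trans (Int.divModEquiv 5).symm).tsum_eq f
  have e3 : (f ∘ ⇑((Equiv.prodComm (Fin 5) ℤ).trans (Int.divModEquiv 5).symm))
      = fun x : Fin 5 × ℤ => f (5 * x.2 + (x.1 : ℕ)) := by
    funext x
    simp [Int.divModEquiv]
    congr 1; ring
  rw [e3] at e2
  rw [← e1]
  have e4 := e2.tsum_prod
  rw [tsum_fintype (fun b : Fin 5 => ∑' c : ℤ, f (5 * c + ((b : ℕ) : ℤ))), Fin.sum_univ_five] at e4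
  refine (tsum_congr (fun x => congrFun e3 x)).trans (e4.trans ?_)
  have s3 : ∑' m : ℤ, f (5 * m - 2) = ∑' m : ℤ, f (5 * m + 3) := by
    rw [← ts_shift2]
    refine tsum_congr (fun m => ?_)
    congr 1; ring
  have s4 : ∑' m : ℤ, f (5 * m - 1) = ∑' m : ℤ, f (5 * m + 4) := by
    rw [← ts_shift2]
    refine tsum_congr (fun m => ?_)
    congr 1; ring
  rw [s3, s4]
  simp
  ring

lemma dissect (w z : ℂ) (hw0 : w ≠ 0) (hw : ‖w‖ < 1) (hz : z ≠ 0) :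
    jj w z = jj (w ^ 25) (w ^ 20 * z ^ 5) - z * jj (w ^ 25) (w ^ 30 * z ^ 5)
      + w ^ 2 * z ^ 2 * jj (w ^ 25) (w ^ 40 * z ^ 5) - w ^ 2 * z⁻¹ * jj (w ^ 25) (w ^ 10 * z ^ 5)
      + w ^ 6 * (z ^ 2)⁻¹ * jj (w ^ 25) (z ^ 5) := by
  have key : ∀ (r : ℤ) (k : ℕ) (c : ℂ), (20 + 10 * r = k) → c = (-1) ^ r * w ^ (r ^ 2 - r) * z ^ r →
      ∑' m : ℤ, (-1 : ℂ) ^ (5 * m + r) * w ^ ((5 * m + r) ^ 2 - (5 * m + r)) * z ^ (5 * m + r)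
      = c * jj (w ^ 25) (w ^ k * z ^ 5) := by
    rintro r k c hk rfl
    unfold jj
    rw [← tsum_mul_left]
    refine tsum_congr (fun m => ?_)
    rw [show (5 * m + r) ^ 2 - (5 * m + r) = (25 : ℕ) * (m ^ 2 - m) + k * m + (r ^ 2 - r) by
      rw [← hk]; push_cast; ring, zpow_add₀ (by norm_num), zpow_add₀ hw0, zpow_add₀ hw0,
      zpow_add₀ hz, mul_zpow, zpow_mul, zpow_mul, zpow_mul, zpow_mul, zpow_natCast, zpow_natCast]
    norm_num
    norm_cast
    ring
  have k0 := key 0 20 1 (by norm_num) (by simp)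
  have k1 := key 1 30 (-z) (by norm_num) (by simp)
  have k2 := key 2 40 (w ^ 2 * z ^ 2) (by norm_num) (by norm_num <;> norm_cast)
  have k3 := key (-1) 10 (-(w ^ 2 * z⁻¹)) (by norm_num) (by norm_num <;> norm_cast)
  have k4 := key (-2) 0 (w ^ 6 * (z ^ 2)⁻¹) (by norm_num) (by norm_num <;> norm_cast)
  have h := ts_mod5 _ (jj_summable w z hw0 hw hz)
  unfold jj at k0 k1 k2 k3 k4 ⊢
  simp only [← sub_eq_add_neg, add_zero, pow_zero, one_mul] at k0 k1 k2 k3 k4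
  rw [h, k0, k1, k2, k3, k4]
  ring

lemma phi_jj (q : ℂ) (hq0 : q ≠ 0) (hq : ‖q‖ < 1) : phiNeg q = jj q q := by
  have h2 : ‖q ^ 2‖ < 1 := norm_pow_lt hq (by norm_num)
  have := qp_ne _ _ h2 h2
  rw [jtp q q hq0 hq hq0, phiNeg, qp_split 2 q q hq]
  simp only [Finset.prod_range_succ, Finset.prod_range_zero, pow_zero, pow_one, mul_one, one_mul]
  rw [show q ^ 2 / q = q by field_simp, show q * q = q ^ 2 by ring]
  field_simp

lemma E_jj (u : ℂ) (hq0 : u ≠ 0) (hq : ‖u‖ < 1) :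
    qpoch (u ^ 2) (u ^ 2) = jj (u ^ 3) (u ^ 2) := by
  have h2 : ‖u ^ 2‖ < 1 := norm_pow_lt hq (by norm_num)
  have h3 : ‖u ^ 3‖ < 1 := norm_pow_lt hq (by norm_num)
  rw [jtp (u ^ 3) (u ^ 2) (pow_ne_zero _ hq0) h3 (pow_ne_zero _ hq0), qp_split 3 _ _ h2]
  simp only [Finset.prod_range_succ, Finset.prod_range_zero, pow_zero, pow_one, mul_one, one_mul]
  rw [show (u ^ 3) ^ 2 / u ^ 2 = u ^ 4 by field_simp]
  ring_nf

lemma phi_dissect (q : ℂ) (hq0 : q ≠ 0) (hq : ‖q‖ < 1) :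
    phiNeg q = jj ((q ^ 5) ^ 5) ((q ^ 5) ^ 5) - 2 * q * jj ((q ^ 5) ^ 5) ((q ^ 5) ^ 3)
      + 2 * q ^ 4 * jj ((q ^ 5) ^ 5) (q ^ 5) := by
  have h5 := norm_pow_lt hq (n := 5) (by norm_num)
  have h50 := pow_ne_zero 5 hq0
  rw [phi_jj q hq0 hq, dissect q q hq0 hq hq0]
  have a := J73 (q ^ 5) h50 h5
  have b := J91 (q ^ 5) h50 h5
  rw [show q ^ 2 * q⁻¹ = q by field_simp, show q ^ 6 * (q ^ 2)⁻¹ = q ^ 4 by field_simp,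
    show q ^ 25 = (q ^ 5) ^ 5 by ring, show q ^ 20 * q ^ 5 = (q ^ 5) ^ 5 by ring,
    show q ^ 30 * q ^ 5 = (q ^ 5) ^ 7 by ring, show q ^ 40 * q ^ 5 = (q ^ 5) ^ 9 by ring,
    show q ^ 10 * q ^ 5 = (q ^ 5) ^ 3 by ring, a, b]
  ring

/-- dissection of the Euler product with the quintuple product relations -/
lemma E_dissect (u : ℂ) (hq0 : u ≠ 0) (hq : ‖u‖ < 1) : ∃ α γ : ℂ → ℂ,
    (∀ y, y ^ 5 = u ^ 5 → qpoch (y ^ 2) (y ^ 2) = α (u ^ 5) - y ^ 2 * qpoch ((u ^ 5) ^ 10) ((u ^ 5) ^ 10)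
      + y ^ 4 * γ (u ^ 5)) ∧
    α (u ^ 5) * jj ((u ^ 5) ^ 5) ((u ^ 5) ^ 2) = qpoch ((u ^ 5) ^ 10) ((u ^ 5) ^ 10) * jj ((u ^ 5) ^ 5) ((u ^ 5) ^ 4) ∧
    γ (u ^ 5) * jj ((u ^ 5) ^ 5) ((u ^ 5) ^ 4) = - (qpoch ((u ^ 5) ^ 10) ((u ^ 5) ^ 10) * jj ((u ^ 5) ^ 5) ((u ^ 5) ^ 2)) := by
  refine ⟨fun v => jj (v ^ 15) (v ^ 14) + v ^ 2 * jj (v ^ 15) (v ^ 26),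
    fun v => - jj (v ^ 15) (v ^ 8) + v ^ 2 * jj (v ^ 15) (v ^ 2), ?_, ?_⟩
  · intro y hy
    have hy0 : y ≠ 0 := by
      rintro rfl
      exact pow_ne_zero 5 hq0 (by rw [← hy]; norm_num)
    have hyn : ‖y‖ < 1 := by
      have : ‖y ^ 5‖ < 1 := by rw [hy]; exact norm_pow_lt hq (by norm_num)
      rw [norm_pow] at this
      by_contra hc
      exact absurd this (not_lt.2 (one_le_pow₀ (not_lt.1 hc)))
    have hv0 : y ^ 5 ≠ 0 := pow_ne_zero _ hy0
    have hv : ‖y ^ 5‖ < 1 := norm_pow_lt hyn (by norm_num)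
    rw [← hy, E_jj y hy0 hyn, dissect (y ^ 3) (y ^ 2) (pow_ne_zero _ hy0)
      (norm_pow_lt hyn (by norm_num)) (pow_ne_zero _ hy0)]
    have e := E_jj ((y ^ 5) ^ 5) (pow_ne_zero _ hv0) (norm_pow_lt hv (by norm_num))
    have s := jj_symm' ((y ^ 5) ^ 15) ((y ^ 5) ^ 10) ((y ^ 5) ^ 20) (pow_ne_zero _ hv0)
      (norm_pow_lt hv (by norm_num)) (pow_ne_zero _ hv0) (by ring)
    rw [show ((y ^ 5) ^ 5) ^ 2 = (y ^ 5) ^ 10 by ring, show ((y ^ 5) ^ 5) ^ 3 = (y ^ 5) ^ 15 by ring,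
      ← s] at e
    rw [e, show (y ^ 3) ^ 2 * (y ^ 2)⁻¹ = y ^ 4 by field_simp,
      show (y ^ 3) ^ 6 * ((y ^ 2) ^ 2)⁻¹ = y ^ 14 by field_simp,
      show (y ^ 3) ^ 25 = (y ^ 5) ^ 15 by ring,
      show (y ^ 3) ^ 20 * (y ^ 2) ^ 5 = (y ^ 5) ^ 14 by ring,
      show (y ^ 3) ^ 30 * (y ^ 2) ^ 5 = (y ^ 5) ^ 20 by ring,
      show (y ^ 3) ^ 40 * (y ^ 2) ^ 5 = (y ^ 5) ^ 26 by ring,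
      show (y ^ 3) ^ 10 * (y ^ 2) ^ 5 = (y ^ 5) ^ 8 by ring,
      show (y ^ 2) ^ 5 = (y ^ 5) ^ 2 by ring]
    ring
  · have hv0 : u ^ 5 ≠ 0 := pow_ne_zero _ hq0
    have hv : ‖u ^ 5‖ < 1 := norm_pow_lt hq (by norm_num)
    generalize u ^ 5 = v at hv0 hv
    have v50 : v ^ 5 ≠ 0 := pow_ne_zero _ hv0
    have v5 : ‖v ^ 5‖ < 1 := norm_pow_lt hv (by norm_num)
    have v150 : v ^ 15 ≠ 0 := pow_ne_zero _ hv0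
    have v15 : ‖v ^ 15‖ < 1 := norm_pow_lt hv (by norm_num)
    have e := E_jj (v ^ 5) v50 v5
    rw [show (v ^ 5) ^ 2 = v ^ 10 by ring, show (v ^ 5) ^ 3 = v ^ 15 by ring] at e
    have q1 := qpi (v ^ 5) (v ^ 2) v50 v5 (pow_ne_zero _ hv0)
    have q2 := qpi (v ^ 5) (v ^ 4) v50 v5 (pow_ne_zero _ hv0)
    have s1 := jj_symm' (v ^ 15) (v ^ 14) (v ^ 16) v150 v15 (pow_ne_zero _ hv0) (by ring)
    have s2 := jj_symm' (v ^ 15) (v ^ 8) (v ^ 22) v150 v15 (pow_ne_zero _ hv0) (by ring)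
    have s3 := jj_symm' (v ^ 5) (v ^ 2) (v ^ 8) v50 v5 (pow_ne_zero _ hv0) (by ring)
    have s4 := jj_shift (v ^ 15) (v ^ 2) v150 (pow_ne_zero _ hv0)
    rw [show (v ^ 5) ^ 3 = v ^ 15 by ring, show (v ^ 5) ^ 2 * (v ^ 2) ^ 3 = v ^ 16 by ring,
      show (v ^ 5) ^ 4 * (v ^ 2) ^ 3 = v ^ 26 by ring, show (v ^ 5) ^ 2 = v ^ 10 by ring,
      show (v ^ 2) ^ 2 = v ^ 4 by ring, s1, ← e] at q1
    rw [show (v ^ 5) ^ 3 = v ^ 15 by ring, show (v ^ 5) ^ 2 * (v ^ 4) ^ 3 = v ^ 22 by ring,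
      show (v ^ 5) ^ 4 * (v ^ 4) ^ 3 = (v ^ 15) ^ 2 * v ^ 2 by ring,
      show (v ^ 5) ^ 2 = v ^ 10 by ring,
      show (v ^ 4) ^ 2 = v ^ 8 by ring, s2, s3, s4, ← e,
      show v ^ 4 * -((v ^ 2)⁻¹ * jj (v ^ 15) (v ^ 2)) = - (v ^ 2 * jj (v ^ 15) (v ^ 2)) by
        field_simp] at q2
    refine ⟨q1, ?_⟩
    linear_combination -q2


lemma filter5 (z K c0 c1 c2 c3 c4 : ℂ) (hP : 1 + z + z ^ 2 + z ^ 3 + z ^ 4 = 0)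
    (e0 : c0 + c1 + c2 + c3 + c4 = K)
    (e1 : c0 + z * c1 + z ^ 2 * c2 + z ^ 3 * c3 + z ^ 4 * c4 = K)
    (e2 : c0 + z ^ 2 * c1 + z ^ 4 * c2 + z * c3 + z ^ 3 * c4 = K)
    (e3 : c0 + z ^ 3 * c1 + z * c2 + z ^ 4 * c3 + z ^ 2 * c4 = K)
    (e4 : c0 + z ^ 4 * c1 + z ^ 3 * c2 + z ^ 2 * c3 + z * c4 = K) :
    c0 = K ∧ c1 = 0 ∧ c2 = 0 ∧ c3 = 0 ∧ c4 = 0 := by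
  refine ⟨?_, ?_, ?_, ?_, ?_⟩
  · linear_combination 1/5*(z^0*e0+z^0*e1+z^0*e2+z^0*e3+z^0*e4) + 1/5*((-1)*c4 + (-1)*c2 +
      (-1)*c3 + (-1)*c1^1)*hP
  · linear_combination 1/5*(z^0*e0+z^4*e1+z^3*e2+z^2*e3+z*e4) + 1/5*((-1)*z^4*c4 + (-1)*z^3*c3 +
      (-1)*z^3*c2 + z^3*c4 + (-1)*z^2*c4 + (-4)*z*c1 + z*c3 + z*c2 + z*c4 + K + (-1)*c0 + (4)*c1
      + (-1)*c3 + (-1)*c2 + (-1)*c4^1)*hP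
  · linear_combination 1/5*(z^0*e0+z^3*e1+z*e2+z^4*e3+z^2*e4) + 1/5*((-1)*z^4*c3 + (-1)*z^3*c4 +
      (-1)*z^3*c1 + z^3*c3 + (-1)*z^2*c3 + (-4)*z*c2 + z*c4 + z*c1 + z*c3 + K + (-1)*c0 + (4)*c2
      + (-1)*c4 + (-1)*c1 + (-1)*c3^1)*hP
  · linear_combination 1/5*(z^0*e0+z^2*e1+z^4*e2+z*e3+z^3*e4) + 1/5*((-1)*z^4*c2 + (-1)*z^3*c4 +
      (-1)*z^3*c1 + z^3*c2 + (-1)*z^2*c2 + (-4)*z*c3 + z*c4 + z*c1 + z*c2 + K + (-1)*c0 + (4)*c3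
      + (-1)*c4 + (-1)*c1 + (-1)*c2^1)*hP
  · linear_combination 1/5*(z^0*e0+z*e1+z^2*e2+z^3*e3+z^4*e4) + 1/5*((-1)*z^4*c1 + (-1)*z^3*c3 +
      (-1)*z^3*c2 + z^3*c1 + (-1)*z^2*c1 + (-4)*z*c4 + z*c3 + z*c2 + z*c1 + K + (-1)*c0 + (4)*c4
      + (-1)*c3 + (-1)*c2 + (-1)*c1^1)*hP

lemma norm5 (z P a b : ℂ) (hP : 1 + z + z ^ 2 + z ^ 3 + z ^ 4 = 0) :
    (P + a + b) * (P + z * a + z ^ 4 * b) * (P + z ^ 2 * a + z ^ 3 * b) *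
      (P + z ^ 3 * a + z ^ 2 * b) * (P + z ^ 4 * a + z * b)
    = P ^ 5 + a ^ 5 + b ^ 5 - 5 * P ^ 3 * a * b + 5 * P * a ^ 2 * b ^ 2 := by
  linear_combination (z^10*P*a^2*b^2 + z^10*a^3*b^2 + z^10*a^2*b^3 + z^9*P*a^3*b + z^9*P*a*b^3 +
      z^9*a^4*b + z^9*a*b^4 + (-1)*z^9*P*a^2*b^2 + (-1)*z^8*P*a^3*b + (-1)*z^8*P*a*b^3 +
      (-1)*z^8*a^4*b + (-1)*z^8*a*b^4 + z^8*P*a^2*b^2 + (2)*z^7*P*a^3*b + z^7*P^2*a^2*b +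
      z^7*P^2*a*b^2 + (2)*z^7*P*a*b^3 + z^7*P*a^2*b^2 + z^7*a^4*b + z^7*a*b^4 + z^6*P^2*a^2*b +
      z^6*P*a^4 + (4)*z^6*P*a^2*b^2 + z^6*P^2*a*b^2 + z^6*P*b^4 + z^6*a^5 + z^6*a^3*b^2 +
      z^6*a^2*b^3 + z^6*b^5 + z^5*P^2*a^3 + z^5*P*a^3*b + z^5*P*a*b^3 + z^5*P^2*b^3 +
      (-3)*z^5*P*a^2*b^2 + (-1)*z^5*P^2*a^2*b + (-1)*z^5*P^2*a*b^2 + (-1)*z^5*a^5 + (-1)*z^5*b^5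
      + (2)*z^4*P^2*a^2*b + (2)*z^4*P*a^2*b^2 + z^4*P^3*a*b + (2)*z^4*P^2*a*b^2 + z^4*P*a^3*b +
      z^4*P*a*b^3 + z^3*P^3*a^2 + z^3*P^3*a*b + (2)*z^3*P^2*a*b^2 + (2)*z^3*P^2*a^2*b +
      z^3*P^2*a^3 + z^3*P^2*b^3 + z^3*P^3*b^2 + z^2*P^3*a*b + z^2*P^2*a^2*b + z^2*P^2*a*b^2 +
      z*P^3*a^2 + z*P^3*b^2 + (5)*z*P*a^2*b^2 + z*a^5 + z*b^5 + (-3)*z*P^3*a*b + P^4*a +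
      (5)*P^3*a*b + P^4*b + (-5)*P*a^2*b^2 + (-1)*a^5 + (-1)*b^5)*hP

lemma cof5 (P a b K X0 X1 X2 X3 X4 : ℂ) (h0 : X0 * P + X4 * a + X1 * b = K)
    (h1 : X1 * P + X0 * a + X2 * b = 0) (h2 : X2 * P + X1 * a + X3 * b = 0)
    (h3 : X3 * P + X2 * a + X4 * b = 0) (h4 : X4 * P + X3 * a + X0 * b = 0) :
    X2 * (P ^ 5 + a ^ 5 + b ^ 5 - 5 * P ^ 3 * a * b + 5 * P * a ^ 2 * b ^ 2)
      = K * (P ^ 2 * a ^ 2 - P * b ^ 3 - a ^ 3 * b) := by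
  linear_combination (P ^ 2 * a ^ 2 - P * b ^ 3 - a ^ 3 * b) * h0
    + (-P ^ 3 * a + 2 * P * a ^ 2 * b + b ^ 4) * h1
    + (P ^ 4 - 3 * P ^ 2 * a * b + a ^ 2 * b ^ 2) * h2
    + (-P ^ 3 * b + 2 * P * a * b ^ 2 + a ^ 4) * h3
    + (P ^ 2 * b ^ 2 - a * b ^ 3 - P * a ^ 3) * h4

lemma extract5 (z q P a b K A0 A1 A2 A3 A4 : ℂ) (D : ℂ → ℂ) (hz : IsPrimitiveRoot z 5)
    (hq0 : q ≠ 0) (hD : ∀ y, y ^ 5 = q ^ 5 → D y = P + y * a + y ^ 4 * b)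
    (hF : ∀ y, y ^ 5 = q ^ 5 → (A0 + y * A1 + y ^ 2 * A2 + y ^ 3 * A3 + y ^ 4 * A4) * D y = K) :
    A2 * (D q * D (z * q) * D (z ^ 2 * q) * D (z ^ 3 * q) * D (z ^ 4 * q))
      = K * (P ^ 2 * a ^ 2 - q ^ 10 * P * b ^ 3 - q ^ 5 * a ^ 3 * b) := by
  have hz5 : z ^ 5 = 1 := hz.pow_eq_one
  have hP : 1 + z + z ^ 2 + z ^ 3 + z ^ 4 = 0 := by
    have := hz.geom_sum_eq_zero (by norm_num)
    simpa [Finset.sum_range_succ] using this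
  have hy : ∀ k : ℕ, (z ^ k * q) ^ 5 = q ^ 5 := by
    intro k
    rw [mul_pow, ← pow_mul, mul_comm k, pow_mul, hz5, one_pow, one_mul]
  have y0 : q ^ 5 = q ^ 5 := rfl
  have y1 : (z * q) ^ 5 = q ^ 5 := by simpa using hy 1
  have p6 : z ^ 6 = z := by linear_combination z * hz5
  have p8 : z ^ 8 = z ^ 3 := by linear_combination z ^ 3 * hz5
  have p9 : z ^ 9 = z ^ 4 := by linear_combination z ^ 4 * hz5
  have p12 : z ^ 12 = z ^ 2 := by linear_combination (z ^ 7 + z ^ 2) * hz5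
  have p16 : z ^ 16 = z := by linear_combination (z ^ 11 + z ^ 6 + z) * hz5
  have d0 := hD q y0
  have d1 : D (z * q) = P + z * (q * a) + z ^ 4 * (q ^ 4 * b) := by
    rw [hD _ y1]; ring
  have d2 : D (z ^ 2 * q) = P + z ^ 2 * (q * a) + z ^ 3 * (q ^ 4 * b) := by
    rw [hD _ (hy 2)]; linear_combination q ^ 4 * b * p8
  have d3 : D (z ^ 3 * q) = P + z ^ 3 * (q * a) + z ^ 2 * (q ^ 4 * b) := by
    rw [hD _ (hy 3)]; linear_combination q ^ 4 * b * p12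
  have d4 : D (z ^ 4 * q) = P + z ^ 4 * (q * a) + z * (q ^ 4 * b) := by
    rw [hD _ (hy 4)]; linear_combination q ^ 4 * b * p16
  have f0 := hF q y0
  have f1 := hF _ y1
  have f2 := hF _ (hy 2)
  have f3 := hF _ (hy 3)
  have f4 := hF _ (hy 4)
  rw [d0] at f0
  rw [d1] at f1
  rw [d2] at f2
  rw [d3] at f3
  rw [d4] at f4
  have n := norm5 z P (q * a) (q ^ 4 * b) hP
  obtain ⟨X0, hX0⟩ : ∃ X, X = A0 := ⟨_, rfl⟩
  obtain ⟨X1, hX1⟩ : ∃ X, X = q * A1 := ⟨_, rfl⟩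
  obtain ⟨X2, hX2⟩ : ∃ X, X = q ^ 2 * A2 := ⟨_, rfl⟩
  obtain ⟨X3, hX3⟩ : ∃ X, X = q ^ 3 * A3 := ⟨_, rfl⟩
  obtain ⟨X4, hX4⟩ : ∃ X, X = q ^ 4 * A4 := ⟨_, rfl⟩
  obtain ⟨a', ha⟩ : ∃ X, X = q * a := ⟨_, rfl⟩
  obtain ⟨b', hb⟩ : ∃ X, X = q ^ 4 * b := ⟨_, rfl⟩
  have g0 : (X0 + X1 + X2 + X3 + X4) * (P + a' + b') = K := by
    rw [← f0, hX0, hX1, hX2, hX3, hX4, ha, hb]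
  have g1 : (X0 + z * X1 + z ^ 2 * X2 + z ^ 3 * X3 + z ^ 4 * X4) * (P + z * a' + z ^ 4 * b') = K := by
    rw [← f1, hX0, hX1, hX2, hX3, hX4, ha, hb]; ring
  have g2 : (X0 + z ^ 2 * X1 + z ^ 4 * X2 + z * X3 + z ^ 3 * X4) * (P + z ^ 2 * a' + z ^ 3 * b') = K := by
    rw [← f2, hX0, hX1, hX2, hX3, hX4, ha, hb]
    linear_combination -(P + z ^ 2 * (q * a) + z ^ 3 * (q ^ 4 * b)) *
      (q ^ 3 * A3 * p6 + q ^ 4 * A4 * p8)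
  have g3 : (X0 + z ^ 3 * X1 + z * X2 + z ^ 4 * X3 + z ^ 2 * X4) * (P + z ^ 3 * a' + z ^ 2 * b') = K := by
    rw [← f3, hX0, hX1, hX2, hX3, hX4, ha, hb]
    linear_combination -(P + z ^ 3 * (q * a) + z ^ 2 * (q ^ 4 * b)) *
      (q ^ 2 * A2 * p6 + q ^ 3 * A3 * p9 + q ^ 4 * A4 * p12)
  have g4 : (X0 + z ^ 4 * X1 + z ^ 3 * X2 + z ^ 2 * X3 + z * X4) * (P + z ^ 4 * a' + z * b') = K := by
    rw [← f4, hX0, hX1, hX2, hX3, hX4, ha, hb]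
    linear_combination -(P + z ^ 4 * (q * a) + z * (q ^ 4 * b)) *
      (q ^ 2 * A2 * p8 + q ^ 3 * A3 * p12 + q ^ 4 * A4 * p16)
  obtain ⟨h0, h1, h2, h3, h4⟩ := filter5 z K (X0 * P + X4 * a' + X1 * b')
    (X1 * P + X0 * a' + X2 * b') (X2 * P + X1 * a' + X3 * b') (X3 * P + X2 * a' + X4 * b')
    (X4 * P + X3 * a' + X0 * b') hP (by rw [← g0]; ring)
    (by rw [← g1]; linear_combination
            -(X4 * a' + X1 * b' + z * X2 * b' + z ^ 2 * X3 * b' + z ^ 3 * X4 * b') * hz5)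
    (by rw [← g2]; linear_combination
            -(z * X2 * a' + X4 * a' + X1 * b' + z ^ 2 * X2 * b' + z * X4 * b') * hz5)
    (by rw [← g3]; linear_combination
            -(z * X1 * a' + z ^ 2 * X3 * a' + X4 * a' + X1 * b' + z * X3 * b') * hz5)
    (by rw [← g4]; linear_combination
            -(z ^ 3 * X1 * a' + z ^ 2 * X2 * a' + z * X3 * a' + X4 * a' + X1 * b') * hz5)
  have r := cof5 _ _ _ _ _ _ _ _ _ h0 h1 h2 h3 h4
  rw [ha, hb, ← n, ← d0, ← d1, ← d2, ← d3, ← d4, hX2] at r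
  have q2 : q ^ 2 ≠ 0 := pow_ne_zero _ hq0
  apply mul_left_cancel₀ q2
  linear_combination r


open Filter Topology

lemma ts_nmod5 (f : ℕ → ℂ) (hf : Summable f) :
    ∑' n, f n = ∑' m, f (5 * m) + ∑' m, f (5 * m + 1) + ∑' m, f (5 * m + 2)
      + ∑' m, f (5 * m + 3) + ∑' m, f (5 * m + 4) := by
  have e2 := (((Equiv.prodComm (Fin 5) ℕ).trans (Nat.divModEquiv 5).symm).summable_iff
    (f := f)).2 hf
  have e1 := ((Equiv.prodComm (Fin 5) ℕ).trans (Nat.divModEquiv 5).symm).tsum_eq f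
  have e3 : (f ∘ ⇑((Equiv.prodComm (Fin 5) ℕ).trans (Nat.divModEquiv 5).symm))
      = fun x : Fin 5 × ℕ => f (5 * x.2 + (x.1 : ℕ)) := by
    funext x
    simp [Nat.divModEquiv]
    congr 1; ring
  rw [e3] at e2
  rw [← e1]
  have e4 := e2.tsum_prod
  rw [tsum_fintype (fun b : Fin 5 => ∑' c : ℕ, f (5 * c + (b : ℕ))), Fin.sum_univ_five] at e4
  refine (tsum_congr (fun x => congrFun e3 x)).trans (e4.trans ?_)
  simp

lemma ser5 (f : ℕ → ℂ) (y Q : ℂ) (hQ : y ^ 5 = Q) (hf : Summable fun n => f n * y ^ n) :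
    ∑' n, f n * y ^ n = (∑' m, f (5 * m) * Q ^ m) + y * (∑' m, f (5 * m + 1) * Q ^ m)
      + y ^ 2 * (∑' m, f (5 * m + 2) * Q ^ m) + y ^ 3 * (∑' m, f (5 * m + 3) * Q ^ m)
      + y ^ 4 * (∑' m, f (5 * m + 4) * Q ^ m) := by
  rw [ts_nmod5 _ hf]
  simp only [← tsum_mul_left, ← hQ, ← pow_mul]
  congr 1
  · congr 1
    · congr 1
      · congr 1
        refine tsum_congr (fun m => ?_)
        ring
      · refine tsum_congr (fun m => ?_)
        ring
    · refine tsum_congr (fun m => ?_)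
      ring
  · refine tsum_congr (fun m => ?_)
    ring

lemma phi_ne (q : ℂ) (hq : ‖q‖ < 1) : phiNeg q ≠ 0 :=
  div_ne_zero (pow_ne_zero _ (qp_ne _ _ hq hq))
    (qp_ne _ _ (norm_pow_lt hq (by norm_num)) (norm_pow_lt hq (by norm_num)))

lemma norm_of_pow5 {y q : ℂ} (h : y ^ 5 = q ^ 5) (hq : ‖q‖ < 1) : ‖y‖ < 1 := by
  have : ‖y ^ 5‖ < 1 := by rw [h]; exact norm_pow_lt hq (by norm_num)
  rw [norm_pow] at this
  by_contra hc
  exact absurd this (not_lt.2 (one_le_pow₀ (not_lt.1 hc)))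

lemma sum_of_ne {f : ℕ → ℂ} {x : ℂ} (h : ∑' n, f n = x) (hx : x ≠ 0) : Summable f := by
  by_contra hc
  exact hx (by rw [← h, tsum_eq_zero_of_not_summable hc])

lemma phi_sum (a : ℕ → ℂ)
    (ha : ∀ q : ℂ, ‖q‖ < 1 → ∑' n : ℕ, a n * q ^ n = phiNeg (q ^ 5) ^ 5 / phiNeg q)
    (q : ℂ) (hq : ‖q‖ < 1) : Summable fun n => a n * q ^ n :=
  sum_of_ne (ha q hq) (div_ne_zero (pow_ne_zero _ (phi_ne _ (norm_pow_lt hq (by norm_num))))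
    (phi_ne q hq))

lemma E_sum (c : ℕ → ℂ)
    (hc : ∀ q : ℂ, ‖q‖ < 1 → ∑' n : ℕ, c n * q ^ n = qpoch (q ^ 5) (q ^ 5) ^ 5 / qpoch q q)
    (q : ℂ) (hq : ‖q‖ < 1) : Summable fun n => c n * q ^ n := by
  have h5 : ‖q ^ 5‖ < 1 := norm_pow_lt hq (by norm_num)
  exact sum_of_ne (hc q hq) (div_ne_zero (pow_ne_zero _ (qp_ne _ _ h5 h5)) (qp_ne _ _ hq hq))

lemma phi_part (a : ℕ → ℂ)
    (ha : ∀ q : ℂ, ‖q‖ < 1 → ∑' n : ℕ, a n * q ^ n = phiNeg (q ^ 5) ^ 5 / phiNeg q)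
    (z q Q : ℂ) (hz : IsPrimitiveRoot z 5) (hq0 : q ≠ 0) (hq : ‖q‖ < 1) (hQ : q ^ 5 = Q) :
    (∑' m, a (5 * m + 2) * Q ^ m) * phiNeg Q = 4 * jj (Q ^ 5) (Q ^ 5) *
      (jj (Q ^ 5) (Q ^ 5) ^ 2 * jj (Q ^ 5) (Q ^ 3) ^ 2
        - 2 * Q ^ 2 * jj (Q ^ 5) (Q ^ 5) * jj (Q ^ 5) Q ^ 3
        + 4 * Q * jj (Q ^ 5) (Q ^ 3) ^ 3 * jj (Q ^ 5) Q) := by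
  have hQn : ‖Q‖ < 1 := by rw [← hQ]; exact norm_pow_lt hq (by norm_num)
  have hQ0 : Q ≠ 0 := by rw [← hQ]; exact pow_ne_zero _ hq0
  have hn := phi_norm5 z q hq hz
  have hp := phi_ne Q hQn
  have h := extract5 z q (jj (Q ^ 5) (Q ^ 5)) (-2 * jj (Q ^ 5) (Q ^ 3)) (2 * jj (Q ^ 5) Q)
    (phiNeg Q ^ 5) (∑' m, a (5 * m) * Q ^ m) (∑' m, a (5 * m + 1) * Q ^ m)
    (∑' m, a (5 * m + 2) * Q ^ m) (∑' m, a (5 * m + 3) * Q ^ m) (∑' m, a (5 * m + 4) * Q ^ m)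
    phiNeg hz hq0 (by
      intro y hy
      have hy0 : y ≠ 0 := by
        rintro rfl
        exact pow_ne_zero 5 hq0 (by rw [← hy]; norm_num)
      rw [phi_dissect y hy0 (norm_of_pow5 hy hq), hy, hQ]
      ring) (by
      intro y hy
      have hyn := norm_of_pow5 hy hq
      rw [← ser5 a y Q (by rw [hy, hQ]) (phi_sum a ha y hyn), ha y hyn, hy, hQ]
      exact div_mul_cancel₀ _ (phi_ne y hyn))
  have p5 : phiNeg (q ^ 25) = jj (Q ^ 5) (Q ^ 5) := by
    rw [← phi_jj (Q ^ 5) (pow_ne_zero _ hQ0) (norm_pow_lt hQn (by norm_num)), ← hQ]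
    congr 1; ring
  rw [p5, hQ] at hn
  rw [show q ^ 10 = Q ^ 2 by rw [← hQ]; ring, hQ] at h
  apply mul_left_cancel₀ (pow_ne_zero 5 hp)
  linear_combination jj (Q ^ 5) (Q ^ 5) * h - (∑' m, a (5 * m + 2) * Q ^ m) * hn

lemma E_part (c : ℕ → ℂ)
    (hc : ∀ q : ℂ, ‖q‖ < 1 → ∑' n : ℕ, c n * q ^ n = qpoch (q ^ 5) (q ^ 5) ^ 5 / qpoch q q)
    (z u v Q : ℂ) (hz : IsPrimitiveRoot z 5) (hu0 : u ≠ 0) (hu : ‖u‖ < 1) (hv : u ^ 5 = v)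
    (hQ : v ^ 2 = Q) : ∃ α γ : ℂ,
    α * jj (v ^ 5) (v ^ 2) = qpoch (Q ^ 5) (Q ^ 5) * jj (v ^ 5) (v ^ 4) ∧
    γ * jj (v ^ 5) (v ^ 4) = - (qpoch (Q ^ 5) (Q ^ 5) * jj (v ^ 5) (v ^ 2)) ∧
    (∑' m, c (5 * m + 1) * Q ^ m) * qpoch Q Q = qpoch (Q ^ 5) (Q ^ 5) *
      (Q * qpoch (Q ^ 5) (Q ^ 5) ^ 2 * γ ^ 2 + qpoch (Q ^ 5) (Q ^ 5) * α ^ 3 - Q * γ ^ 3 * α) := by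
  obtain ⟨αf, γf, hd, h1, h2⟩ := E_dissect u hu0 hu
  obtain ⟨q, hqu⟩ : ∃ q, q = u ^ 2 := ⟨_, rfl⟩
  have hq0 : q ≠ 0 := by rw [hqu]; exact pow_ne_zero _ hu0
  have hq : ‖q‖ < 1 := by rw [hqu]; exact norm_pow_lt hu (by norm_num)
  have hqQ : q ^ 5 = Q := by rw [hqu, ← hQ, ← hv]; ring
  have hQn : ‖Q‖ < 1 := by rw [← hqQ]; exact norm_pow_lt hq (by norm_num)
  have hQ0 : Q ≠ 0 := by rw [← hqQ]; exact pow_ne_zero _ hq0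
  have hE := qp_ne Q Q hQn hQn
  rw [hv, show v ^ 10 = Q ^ 5 by rw [← hQ]; ring] at h1 h2 hd
  refine ⟨αf v, γf v, h1, h2, ?_⟩
  have hd' : ∀ p, p ^ 5 = q ^ 5 → qpoch p p = αf v - p * qpoch (Q ^ 5) (Q ^ 5) + p ^ 2 * γf v := by
    intro p hp
    have hp0 : p ≠ 0 := by
      rintro rfl
      exact pow_ne_zero 5 hq0 (by rw [← hp]; norm_num)
    have hpv : p ^ 5 = v ^ 2 := by rw [hp, hqQ, hQ]
    have y2 : (v / p ^ 2) ^ 2 = p := by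
      field_simp
      rw [← hpv]
    have y5 : (v / p ^ 2) ^ 5 = v := by
      have : v ≠ 0 := by rw [← hv]; exact pow_ne_zero _ hu0
      rw [div_pow, show (p ^ 2) ^ 5 = (p ^ 5) ^ 2 by ring, hpv]
      field_simp
    have := hd (v / p ^ 2) y5
    rw [show (v / p ^ 2) ^ 4 = ((v / p ^ 2) ^ 2) ^ 2 by ring, y2] at this
    exact this
  have hn := qp_norm5 z q hq hz
  have h := extract5 z q (-Q * qpoch (Q ^ 5) (Q ^ 5)) (Q * γf v) (αf v)
    (Q * qpoch Q Q ^ 5) (Q * (∑' m, c (5 * m + 4) * Q ^ m)) (∑' m, c (5 * m) * Q ^ m)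
    (∑' m, c (5 * m + 1) * Q ^ m) (∑' m, c (5 * m + 2) * Q ^ m) (∑' m, c (5 * m + 3) * Q ^ m)
    (fun y => y ^ 4 * qpoch y y) hz hq0 (by
      intro y hy
      rw [hd' y hy]
      rw [hqQ] at hy
      rw [← hy]
      ring) (by
      intro y hy
      have hyn := norm_of_pow5 hy hq
      have hyQ : y ^ 5 = Q := by rw [hy, hqQ]
      have s := ser5 c y Q hyQ (E_sum c hc y hyn)
      rw [hc y hyn, hyQ, div_eq_iff (qp_ne y y hyn hyn)] at s
      rw [s]
      linear_combination ((∑' m, c (5 * m) * Q ^ m) + y * (∑' m, c (5 * m + 1) * Q ^ m)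
        + y ^ 2 * (∑' m, c (5 * m + 2) * Q ^ m) + y ^ 3 * (∑' m, c (5 * m + 3) * Q ^ m)) *
          qpoch y y * hyQ)
  have hz5 : z ^ 5 = 1 := hz.pow_eq_one
  have hz40 : z ^ 40 = 1 := by rw [show (40 : ℕ) = 5 * 8 by norm_num, pow_mul, hz5, one_pow]
  rw [show q ^ 25 = Q ^ 5 by rw [← hqQ]; ring, hqQ] at hn
  rw [show q ^ 10 = Q ^ 2 by rw [← hqQ]; ring, hqQ] at h
  have hN : (q ^ 4 * qpoch q q) * ((z * q) ^ 4 * qpoch (z * q) (z * q)) *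
      ((z ^ 2 * q) ^ 4 * qpoch (z ^ 2 * q) (z ^ 2 * q)) *
      ((z ^ 3 * q) ^ 4 * qpoch (z ^ 3 * q) (z ^ 3 * q)) *
      ((z ^ 4 * q) ^ 4 * qpoch (z ^ 4 * q) (z ^ 4 * q)) = Q ^ 4 * (qpoch q q *
        qpoch (z * q) (z * q) * qpoch (z ^ 2 * q) (z ^ 2 * q) * qpoch (z ^ 3 * q) (z ^ 3 * q) *
        qpoch (z ^ 4 * q) (z ^ 4 * q)) := by
    rw [← hqQ]
    linear_combination q ^ 20 * (qpoch q q *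
        qpoch (z * q) (z * q) * qpoch (z ^ 2 * q) (z ^ 2 * q) * qpoch (z ^ 3 * q) (z ^ 3 * q) *
        qpoch (z ^ 4 * q) (z ^ 4 * q)) * hz40
  rw [hN] at h
  apply mul_left_cancel₀ (mul_ne_zero (pow_ne_zero 4 hQ0) (pow_ne_zero 5 hE))
  linear_combination qpoch (Q ^ 5) (Q ^ 5) * h - Q ^ 4 * (∑' m, c (5 * m + 1) * Q ^ m) * hn


open Filter Topology

lemma jj_R (Q : ℂ) (hQ0 : Q ≠ 0) (hQ : ‖Q‖ < 1) (k l : ℕ) (hkl : k + l = 10) :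
    jj (Q ^ 5) (Q ^ k) = qpoch (Q ^ k) (Q ^ 10) * qpoch (Q ^ l) (Q ^ 10) *
      qpoch (Q ^ 10) (Q ^ 10) := by
  rw [jtp (Q ^ 5) (Q ^ k) (pow_ne_zero _ hQ0) (norm_pow_lt hQ (by norm_num)) (pow_ne_zero _ hQ0),
    show (Q ^ 5) ^ 2 = Q ^ 10 by ring]
  have : Q ^ 10 / Q ^ k = Q ^ l := by
    have := pow_ne_zero k hQ0
    rw [← hkl, pow_add]; field_simp
  rw [this]

lemma qp_R5 (Q : ℂ) (hQ : ‖Q‖ < 1) (k : ℕ) :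
    qpoch (Q ^ k) (Q ^ 5) = qpoch (Q ^ k) (Q ^ 10) * qpoch (Q ^ (k + 5)) (Q ^ 10) := by
  rw [qp_split 2 (Q ^ k) (Q ^ 5) (norm_pow_lt hQ (by norm_num))]
  simp only [Finset.prod_range_succ, Finset.prod_range_zero, one_mul]
  rw [← pow_mul, ← pow_add, ← pow_mul, ← pow_mul, ← pow_add]
  norm_num

lemma final_alg (Q A2 C1 α γ R1 R2 R3 R4 R5 R6 R7 R8 R9 T : ℂ) (n1 : R1 ≠ 0) (n2 : R2 ≠ 0)
    (n3 : R3 ≠ 0) (n4 : R4 ≠ 0) (n5 : R5 ≠ 0) (n6 : R6 ≠ 0) (n7 : R7 ≠ 0) (n8 : R8 ≠ 0)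
    (n9 : R9 ≠ 0) (nT : T ≠ 0) (J1 J2 J3 J4 J5 E1 E2 E5 G H W : ℂ)
    (j1 : J1 = R1 * R9 * T) (j2 : J2 = R2 * R8 * T) (j3 : J3 = R3 * R7 * T)
    (j4 : J4 = R4 * R6 * T) (j5 : J5 = R5 * R5 * T)
    (e1 : E1 = R1 * R2 * R3 * R4 * R5 * R6 * R7 * R8 * R9 * T) (e2 : E2 = R2 * R4 * R6 * R8 * T)
    (e5 : E5 = R5 * T) (hG : G = R1 * R6 * (R4 * R9) * E5) (hH : H = R2 * R7 * (R3 * R8) * E5)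
    (hα : α * G = E5 * H) (hγ : γ * H = -(E5 * G))
    (hA : A2 * (E1 ^ 2 / E2) = 4 * J5 * W)
    (hW : J1 ^ 2 * J2 ^ 2 * J3 * J4 ^ 3 * W = J5 ^ 2 * (J2 ^ 5 * J3 ^ 5 + 2 * Q * J1 ^ 5 * J4 ^ 5))
    (hC : C1 * E1 = E5 * (Q * E5 ^ 2 * γ ^ 2 + E5 * α ^ 3 - Q * γ ^ 3 * α)) : A2 = 4 * C1 := by
  obtain ⟨X, hX⟩ : ∃ X, X = J2 * J3 := ⟨_, rfl⟩
  obtain ⟨Y, hY⟩ : ∃ Y, Y = J1 * J4 := ⟨_, rfl⟩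
  have nJ1 : J1 ≠ 0 := by rw [j1]; simp [*]
  have nJ2 : J2 ≠ 0 := by rw [j2]; simp [*]
  have nJ3 : J3 ≠ 0 := by rw [j3]; simp [*]
  have nJ4 : J4 ≠ 0 := by rw [j4]; simp [*]
  have nE1 : E1 ≠ 0 := by rw [e1]; simp [*]
  have nE2 : E2 ≠ 0 := by rw [e2]; simp [*]
  have nE5 : E5 ≠ 0 := by rw [e5]; simp [*]
  have nX : X ≠ 0 := by rw [hX]; exact mul_ne_zero nJ2 nJ3
  have nY : Y ≠ 0 := by rw [hY]; exact mul_ne_zero nJ1 nJ4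
  have hGY : G * T = Y * R5 := by rw [hG, hY, e5, j1, j4]; ring
  have hHX : H * T = X * R5 := by rw [hH, hX, e5, j2, j3]; ring
  have aa : α * Y = E5 * X := by
    apply mul_right_cancel₀ n5
    linear_combination T * hα - α * hGY + E5 * hHX
  have gg : γ * X = -(E5 * Y) := by
    apply mul_right_cancel₀ n5
    linear_combination T * hγ - γ * hHX - E5 * hGY
  have a' : α = E5 * X / Y := by rw [eq_div_iff nY, aa]
  have g' : γ = -(E5 * Y) / X := by rw [eq_div_iff nX, gg]
  have hC' : C1 * E1 * (X ^ 2 * Y ^ 3) = E5 ^ 5 * (X ^ 5 + 2 * Q * Y ^ 5) := by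
    rw [hC, a', g']
    field_simp
    ring
  have hW' : X ^ 2 * Y ^ 3 * W = J5 ^ 2 * (X ^ 5 + 2 * Q * Y ^ 5) * (J1 * J3) := by
    rw [hX, hY]
    linear_combination J1 * J3 * hW
  have hP : E2 * J5 ^ 3 * (J1 * J3) = E1 * E5 ^ 5 := by
    rw [e1, e2, e5, j1, j3, j5]; ring
  have hA' : A2 * E1 ^ 2 = 4 * J5 * W * E2 := by
    rw [← hA]; field_simp
  have n : X ^ 2 * Y ^ 3 * E1 ^ 2 ≠ 0 :=
    mul_ne_zero (mul_ne_zero (pow_ne_zero _ nX) (pow_ne_zero _ nY)) (pow_ne_zero _ nE1)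
  apply mul_left_cancel₀ n
  linear_combination X ^ 2 * Y ^ 3 * hA' + 4 * J5 * E2 * hW' +
    4 * (X ^ 5 + 2 * Q * Y ^ 5) * hP - 4 * E1 * hC'

lemma ser_eq (a c : ℕ → ℂ)
    (hc : ∀ q : ℂ, ‖q‖ < 1 → ∑' n : ℕ, c n * q ^ n = qpoch (q ^ 5) (q ^ 5) ^ 5 / qpoch q q)
    (ha : ∀ q : ℂ, ‖q‖ < 1 → ∑' n : ℕ, a n * q ^ n = phiNeg (q ^ 5) ^ 5 / phiNeg q)
    (u v Q : ℂ) (hu0 : u ≠ 0) (hu : ‖u‖ < 1) (hv : u ^ 5 = v) (hQ : v ^ 2 = Q) :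
    ∑' m, a (5 * m + 2) * Q ^ m = 4 * ∑' m, c (5 * m + 1) * Q ^ m := by
  have hz : IsPrimitiveRoot (Complex.exp (2 * Real.pi * Complex.I / (5 : ℕ))) 5 :=
    Complex.isPrimitiveRoot_exp 5 (by norm_num)
  have hv0 : v ≠ 0 := by rw [← hv]; exact pow_ne_zero _ hu0
  have hvn : ‖v‖ < 1 := by rw [← hv]; exact norm_pow_lt hu (by norm_num)
  have hQ0 : Q ≠ 0 := by rw [← hQ]; exact pow_ne_zero _ hv0
  have hQn : ‖Q‖ < 1 := by rw [← hQ]; exact norm_pow_lt hvn (by norm_num)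
  have hA := phi_part a ha _ (u ^ 2) Q hz (pow_ne_zero _ hu0) (norm_pow_lt hu (by norm_num))
    (by rw [← hQ, ← hv]; ring)
  obtain ⟨α, γ, h1, h2, hC⟩ := E_part c hc _ u v Q hz hu0 hu hv hQ
  have hW := poly_target Q _ _ _ _ _ (h421 Q hQ0 hQn) (h432 Q hQ0 hQn)
  have h10 : ‖Q ^ 10‖ < 1 := norm_pow_lt hQn (by norm_num)
  have nR : ∀ k : ℕ, k ≠ 0 → qpoch (Q ^ k) (Q ^ 10) ≠ 0 := fun k hk =>
    qp_ne _ _ h10 (norm_pow_lt hQn hk)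
  have hG : jj (v ^ 5) (v ^ 2) = qpoch (Q ^ 1) (Q ^ 5) * qpoch (Q ^ 4) (Q ^ 5) *
      qpoch (Q ^ 5) (Q ^ 5) := by
    rw [jtp _ _ (pow_ne_zero _ hv0) (norm_pow_lt hvn (by norm_num)) (pow_ne_zero _ hv0),
      show (v ^ 5) ^ 2 / v ^ 2 = Q ^ 4 by rw [← hQ]; field_simp,
      show (v ^ 5) ^ 2 = Q ^ 5 by rw [← hQ]; ring, hQ, pow_one]
  have hH : jj (v ^ 5) (v ^ 4) = qpoch (Q ^ 2) (Q ^ 5) * qpoch (Q ^ 3) (Q ^ 5) *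
      qpoch (Q ^ 5) (Q ^ 5) := by
    rw [jtp _ _ (pow_ne_zero _ hv0) (norm_pow_lt hvn (by norm_num)) (pow_ne_zero _ hv0),
      show (v ^ 5) ^ 2 / v ^ 4 = Q ^ 3 by rw [← hQ]; field_simp,
      show (v ^ 5) ^ 2 = Q ^ 5 by rw [← hQ]; ring, show v ^ 4 = Q ^ 2 by rw [← hQ]; ring]
  rw [qp_R5 Q hQn 1, qp_R5 Q hQn 4] at hG
  rw [qp_R5 Q hQn 2, qp_R5 Q hQn 3] at hH
  have e1 : qpoch Q Q = qpoch (Q ^ 1) (Q ^ 10) * qpoch (Q ^ 2) (Q ^ 10) * qpoch (Q ^ 3) (Q ^ 10) *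
      qpoch (Q ^ 4) (Q ^ 10) * qpoch (Q ^ 5) (Q ^ 10) * qpoch (Q ^ 6) (Q ^ 10) *
      qpoch (Q ^ 7) (Q ^ 10) * qpoch (Q ^ 8) (Q ^ 10) * qpoch (Q ^ 9) (Q ^ 10) *
      qpoch (Q ^ 10) (Q ^ 10) := by
    rw [qp_split 10 Q Q hQn]
    simp only [Finset.prod_range_succ, Finset.prod_range_zero, one_mul, ← pow_succ', zero_add]
  have e2 : qpoch (Q ^ 2) (Q ^ 2) = qpoch (Q ^ 2) (Q ^ 10) * qpoch (Q ^ 4) (Q ^ 10) *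
      qpoch (Q ^ 6) (Q ^ 10) * qpoch (Q ^ 8) (Q ^ 10) * qpoch (Q ^ 10) (Q ^ 10) := by
    rw [qp_split 5 (Q ^ 2) (Q ^ 2) (norm_pow_lt hQn (by norm_num))]
    simp only [Finset.prod_range_succ, Finset.prod_range_zero, one_mul, ← pow_mul, ← pow_add]
  have e5 := qp_R5 Q hQn 5
  have j1 := jj_R Q hQ0 hQn 1 9 (by norm_num)
  have j2 := jj_R Q hQ0 hQn 2 8 (by norm_num)
  have j3 := jj_R Q hQ0 hQn 3 7 (by norm_num)
  have j4 := jj_R Q hQ0 hQn 4 6 (by norm_num)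
  have j5 := jj_R Q hQ0 hQn 5 5 (by norm_num)
  rw [show jj (Q ^ 5) (Q ^ 1) = jj (Q ^ 5) Q by rw [pow_one]] at j1
  unfold phiNeg at hA
  exact final_alg Q _ _ α γ _ _ _ _ _ _ _ _ _ _ (nR 1 (by norm_num)) (nR 2 (by norm_num))
    (nR 3 (by norm_num)) (nR 4 (by norm_num)) (nR 5 (by norm_num)) (nR 6 (by norm_num))
    (nR 7 (by norm_num)) (nR 8 (by norm_num)) (nR 9 (by norm_num)) (nR 10 (by norm_num))
    _ _ _ _ _ _ _ _ _ _ _ j1 j2 j3 j4 j5 e1 e2 e5 hG hH h1 h2 hA hW hC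

lemma sub_sum (f : ℕ → ℂ) (y Q : ℂ) (i : ℕ) (hy : y ≠ 0) (hQ : y ^ 5 = Q)
    (hf : Summable fun n => f n * y ^ n) : Summable fun m => f (5 * m + i) * Q ^ m := by
  have h := (hf.comp_injective (i := fun m : ℕ => 5 * m + i) (fun a b h => by
    simp at h; omega)).mul_right ((y ^ i)⁻¹)
  refine h.congr (fun m => ?_)
  have := pow_ne_zero i hy
  simp only [Function.comp]
  rw [pow_add, pow_mul, hQ]
  field_simp

lemma coeff_zero (d : ℕ → ℂ) (h : ∀ Q : ℂ, Q ≠ 0 → ‖Q‖ < 1 → HasSum (fun m => d m * Q ^ m) 0)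
    (n : ℕ) : d n = 0 := by
  let e : ℕ → ℂ := fun k => Nat.casesOn k 0 d
  have hp : HasFPowerSeriesAt (0 : ℂ → ℂ) (FormalMultilinearSeries.ofScalars ℂ e) 0 := by
    rw [hasFPowerSeriesAt_iff]
    filter_upwards [Metric.ball_mem_nhds (0 : ℂ) one_pos] with z hz
    simp only [FormalMultilinearSeries.coeff_ofScalars, Pi.zero_apply]
    rw [← hasSum_nat_add_iff' 1]
    simp only [Finset.range_one, Finset.sum_singleton, pow_zero, smul_eq_mul]
    have e0 : e 0 = 0 := rfl
    rw [e0, mul_zero, sub_zero]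
    by_cases h0 : z = 0
    · subst h0
      simpa using (hasSum_zero : HasSum (fun _ : ℕ => (0 : ℂ)) 0)
    · have := (h z h0 (by simpa using hz)).mul_left z
      rw [mul_zero] at this
      refine this.congr_fun ?_ 
      intro m
      change z ^ (m + 1) * d m = _
      ring
  have h0 := hp.eq_zero
  have : (FormalMultilinearSeries.ofScalars ℂ e).coeff (n + 1) = 0 := by rw [h0]; rfl
  rw [FormalMultilinearSeries.coeff_ofScalars] at this
  exact this

theorem stmt_0 (c a : ℕ → ℤ)
    (hc : ∀ q : ℂ, ‖q‖ < 1 → ∑' n : ℕ, (c n : ℂ) * q ^ n = qpoch (q ^ 5) (q ^ 5) ^ 5 / qpoch q q)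
    (ha : ∀ q : ℂ, ‖q‖ < 1 → ∑' n : ℕ, (a n : ℂ) * q ^ n = phiNeg (q ^ 5) ^ 5 / phiNeg q) :
    ∀ n : ℕ, a (5 * n + 2) = 4 * c (5 * n + 1) := by
  intro n
  have key := coeff_zero (fun m => (a (5 * m + 2) : ℂ) - 4 * (c (5 * m + 1) : ℂ)) (by
    intro Q hQ0 hQ
    obtain ⟨u, hu⟩ := IsAlgClosed.exists_pow_nat_eq Q (n := 10) (by norm_num)
    have hu0 : u ≠ 0 := by
      rintro rfl
      exact hQ0 (by rw [← hu]; norm_num)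
    have hun : ‖u‖ < 1 := by
      rw [← hu, norm_pow] at hQ
      by_contra hcc
      exact absurd hQ (not_lt.2 (one_le_pow₀ (not_lt.1 hcc)))
    have h := ser_eq (fun n => (a n : ℂ)) (fun n => (c n : ℂ)) hc ha u (u ^ 5) Q hu0 hun rfl
      (by rw [← hu]; ring)
    have hu2 : ‖u ^ 2‖ < 1 := norm_pow_lt hun (by norm_num)
    have s1 := sub_sum _ (u ^ 2) Q 2 (pow_ne_zero _ hu0) (by rw [← hu]; ring)
      (phi_sum _ ha (u ^ 2) hu2)
    have s2 := sub_sum _ (u ^ 2) Q 1 (pow_ne_zero _ hu0) (by rw [← hu]; ring)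
      (E_sum _ hc (u ^ 2) hu2)
    have := s1.hasSum.sub (s2.hasSum.mul_left 4)
    rw [h, sub_self] at this
    refine this.congr_fun ?_
    intro m
    ring) n
  have : (a (5 * n + 2) : ℂ) = 4 * (c (5 * n + 1) : ℂ) := sub_eq_zero.1 key
  exact_mod_cast this
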